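/- Let k > 3 and b be natural numbers, let a/b be an irreducible positive fraction, set ν = max{1, 2^{k−1} − b}, and suppose a ∈ {ν, ν+1, …, 2^{k−1}}. Put α = 1 − 1/(2^{k−1} + a/b). Then the random graph G(n, n^{−α}) obeys the zero-one k-law: for every graph property L expressible by a first-order sentence of quantifier depth at most k, P(G(n, n^{−α}) ⊨ L) tends to 0 or tends to 1 as n → ∞. -/

import Mathlib

open Filter Topology FirstOrder

namespace RandomGraphSpectra

/-- The quantifier depth of a first-order (bounded) formula. -/
def qDepth {L : FirstOrder.Language} {α : Type*} :
    ∀ {n : ℕ}, L.BoundedFormula α n → ℕ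
  | _, .falsum => 0
  | _, .equal _ _ => 0
  | _, .rel _ _ => 0
  | _, .imp f g => max (qDepth f) (qDepth g)
  | _, .all f => qDepth f + 1

/-- A simple graph satisfies a first-order sentence in the language of graphs. -/
def GraphSat {V : Type*} (G : SimpleGraph V) (φ : FirstOrder.Language.graph.Sentence) : Prop :=
  @FirstOrder.Language.Sentence.Realize FirstOrder.Language.graph V G.structure φ

/-- The number of edges of a simple graph. -/
noncomputable def edgeCount {V : Type*} (G : SimpleGraph V) : ℕ := Nat.card G.edgeSet

/-- The probability that `G(n,p)` equals a fixed graph `G` on `{1,…,n}`. -/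
noncomputable def weight (n : ℕ) (p : ℝ) (G : SimpleGraph (Fin n)) : ℝ :=
  p ^ edgeCount G * (1 - p) ^ (n.choose 2 - edgeCount G)

open Classical in
/-- The probability that the Erdős–Rényi random graph `G(n,p)` satisfies a predicate `P`. -/
noncomputable def probPred (n : ℕ) (p : ℝ) (P : SimpleGraph (Fin n) → Prop) : ℝ :=
  ∑ᶠ G : SimpleGraph (Fin n), if P G then weight n p G else 0

/-- The probability that `G(n,p)` satisfies a first-order sentence. -/
noncomputable def probSat (n : ℕ) (p : ℝ) (φ : FirstOrder.Language.graph.Sentence) : ℝ :=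
  probPred n p (fun G => GraphSat G φ)

open Classical in
/-- The probability that the pair of independent random graphs `G(n,p), G(m,q)`
satisfies a predicate `P`. -/
noncomputable def probPred2 (n m : ℕ) (p q : ℝ)
    (P : SimpleGraph (Fin n) → SimpleGraph (Fin m) → Prop) : ℝ :=
  ∑ᶠ G : SimpleGraph (Fin n), ∑ᶠ H : SimpleGraph (Fin m),
    if P G H then weight n p G * weight m q H else 0

/-- The spectrum `S_k^1`: the set of `α ∈ (0,1)` such that for some first-order sentence `φ`
of quantifier depth at most `k`, with `p(n) = n^{-α}`, the probability that `G(n,p(n)) ⊨ φ`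
does not tend to `0` and does not tend to `1`. -/
def S1 (k : ℕ) : Set ℝ :=
  {α | α ∈ Set.Ioo (0 : ℝ) 1 ∧ ∃ φ : FirstOrder.Language.graph.Sentence, qDepth φ ≤ k ∧
    ¬(Tendsto (fun n : ℕ => probSat n ((n : ℝ) ^ (-α)) φ) atTop (nhds 0) ∨
      Tendsto (fun n : ℕ => probSat n ((n : ℝ) ^ (-α)) φ) atTop (nhds 1))}

/-- The spectrum `S_k^2`. -/
def S2 (k : ℕ) : Set ℝ :=
  {α | α ∈ Set.Ioo (0 : ℝ) 1 ∧ ∃ φ : FirstOrder.Language.graph.Sentence, qDepth φ ≤ k ∧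
    ¬∃ δ : ℝ, (δ = 0 ∨ δ = 1) ∧ ∃ ε : ℝ, 0 < ε ∧ ∀ p : ℕ → ℝ,
      (∀ n : ℕ, 1 ≤ n → (n : ℝ) ^ (-α - ε) < p n ∧ p n < (n : ℝ) ^ (-α + ε)) →
      Tendsto (fun n : ℕ => probSat n (p n) φ) atTop (nhds δ)}

/-- `G(n, p(n))` obeys the zero-one `k`-law. -/
def ZeroOneKLaw (k : ℕ) (p : ℕ → ℝ) : Prop :=
  ∀ φ : FirstOrder.Language.graph.Sentence, qDepth φ ≤ k →
    Tendsto (fun n : ℕ => probSat n (p n) φ) atTop (nhds 0) ∨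
    Tendsto (fun n : ℕ => probSat n (p n) φ) atTop (nhds 1)

/-- The density `ρ(G) = e(G)/v(G)` of a graph. -/
noncomputable def density {V : Type*} (G : SimpleGraph V) : ℝ :=
  (Nat.card G.edgeSet : ℝ) / (Nat.card V : ℝ)

/-- A graph is strictly balanced if every proper subgraph with at least one vertex has
strictly smaller density. -/
def StrictlyBalanced {V : Type*} (G : SimpleGraph V) : Prop :=
  ∀ H : G.Subgraph, H ≠ ⊤ → H.verts.Nonempty → density H.coe < density G

/-- `ρ^max(G)`: the maximum density of a subgraph of `G` with at least one vertex. -/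
noncomputable def maxDensity {V : Type*} (G : SimpleGraph V) : ℝ :=
  sSup {x : ℝ | ∃ H : G.Subgraph, H.verts.Nonempty ∧ x = density H.coe}

/-- The relative density `ρ(K,H) = e(K,H)/v(K,H)` of a pair of nested subgraphs. -/
noncomputable def pairDensity {V : Type*} {G : SimpleGraph V} (K H : G.Subgraph) : ℝ :=
  ((Nat.card K.edgeSet : ℝ) - (Nat.card H.edgeSet : ℝ)) /
    ((Nat.card K.verts : ℝ) - (Nat.card H.verts : ℝ))

/-- `ρ^max(G,H)` where the ambient graph `G` corresponds to the top subgraph. -/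
noncomputable def maxPairDensity {V : Type*} {G : SimpleGraph V} (H : G.Subgraph) : ℝ :=
  sSup {x : ℝ | ∃ K : G.Subgraph, H < K ∧ x = pairDensity K H}

/-- `f_α(K,H) = v(K,H) - α·e(K,H)`. -/
noncomputable def fAlpha (α : ℝ) {V : Type*} {G : SimpleGraph V} (K H : G.Subgraph) : ℝ :=
  ((Nat.card K.verts : ℝ) - (Nat.card H.verts : ℝ)) -
    α * ((Nat.card K.edgeSet : ℝ) - (Nat.card H.edgeSet : ℝ))

/-- The pair `(G,H)` is `α`-safe: `f_α(S,H) > 0` for every `S` with `H ⊂ S ⊆ G`. -/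
def AlphaSafe (α : ℝ) {V : Type*} (G : SimpleGraph V) (H : G.Subgraph) : Prop :=
  ∀ S : G.Subgraph, H < S → 0 < fAlpha α S H

/-- The pair `(G,H)` is strictly balanced: `ρ(G,H) > ρ(K,H)` for every `H ⊂ K ⊂ G`. -/
def StrictlyBalancedPair {V : Type*} (G : SimpleGraph V) (H : G.Subgraph) : Prop :=
  ∀ K : G.Subgraph, H < K → K ≠ ⊤ → pairDensity K H < pairDensity (⊤ : G.Subgraph) H

/-- The set `E(K) \ (E(H) ∪ E(K∖H))` is non-empty: `K` has an edge, not an edge of `H`,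
with at least one endpoint in `V(H)`. -/
def TouchesRoots {V : Type*} {G : SimpleGraph V} (H K : G.Subgraph) : Prop :=
  ∃ u v : V, K.Adj u v ∧ ¬H.Adj u v ∧ (u ∈ H.verts ∨ v ∈ H.verts)

/-- `e^min(G,H)` (`G` being the top subgraph). -/
noncomputable def eMin {V : Type*} {G : SimpleGraph V} (H : G.Subgraph) : ℕ :=
  sInf {e : ℕ | ∃ K : G.Subgraph, H < K ∧ TouchesRoots H K ∧
    pairDensity K H = maxPairDensity H ∧ e = Nat.card K.edgeSet - Nat.card H.edgeSet}

/-- `f` realizes a `(G,(r 0,…,r (m-1)))`-extension of the tuple `x` in `Γ`: an injective copy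
of the vertex set of `G` sending the roots to `x` and containing all edges of `E(G)∖E(H)`
as edges outside the root-induced subgraph. -/
def IsExtension {W V : Type*} (Gp : SimpleGraph W) (H : Gp.Subgraph) {m : ℕ}
    (r : Fin m → W) (Γ : SimpleGraph V) (x : Fin m → V) (f : W → V) : Prop :=
  Function.Injective f ∧ (∀ j : Fin m, f (r j) = x j) ∧
    ∀ u v : W, Gp.Adj u v → ¬H.Adj u v →
      Γ.Adj (f u) (f v) ∧ ¬(u ∈ H.verts ∧ v ∈ H.verts)

/-- Strict extension: the implication above is an equivalence. -/
def IsStrictExtension {W V : Type*} (Gp : SimpleGraph W) (H : Gp.Subgraph) {m : ℕ}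
    (r : Fin m → W) (Γ : SimpleGraph V) (x : Fin m → V) (f : W → V) : Prop :=
  Function.Injective f ∧ (∀ j : Fin m, f (r j) = x j) ∧
    ∀ u v : W, (Gp.Adj u v ∧ ¬H.Adj u v) ↔
      (Γ.Adj (f u) (f v) ∧ ¬(u ∈ H.verts ∧ v ∈ H.verts))

/-- The pair of subgraphs of `Γ` with vertex sets `B ⊆ A` is `(K,T)`-maximal in `Γ`
(where `T ⊂ K` has roots enumerated by `s`). -/
def PairMaximal {U V : Type*} (Kp : SimpleGraph U) (T : Kp.Subgraph) {t : ℕ}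
    (s : Fin t → U) (Γ : SimpleGraph V) (A B : Set V) : Prop :=
  ∀ tup : Fin t → V, Function.Injective tup → (∀ i, tup i ∈ A) → (∃ i, tup i ∉ B) →
    ¬∃ f : U → V, IsStrictExtension Kp T s Γ tup f ∧
      (∀ u : U, f u ∈ A → f u ∈ Set.range tup) ∧
      (∀ u : U, f u ∉ Set.range tup → ∀ a ∈ A, a ∉ Set.range tup → ¬Γ.Adj (f u) a)

/-- The subgraph of `Γ` with vertex set `A` is `(K,T)`-maximal in `Γ`. -/
def GraphMaximal {U V : Type*} (Kp : SimpleGraph U) (T : Kp.Subgraph) {t : ℕ}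
    (s : Fin t → U) (Γ : SimpleGraph V) (A : Set V) : Prop :=
  ∀ tup : Fin t → V, Function.Injective tup → (∀ i, tup i ∈ A) →
    ¬∃ f : U → V, IsStrictExtension Kp T s Γ tup f ∧
      (∀ u : U, f u ∈ A → f u ∈ Set.range tup) ∧
      (∀ u : U, f u ∉ Set.range tup → ∀ a ∈ A, a ∉ Set.range tup → ¬Γ.Adj (f u) a)

/-- `Γ` contains a copy of `Gp`. -/
def ContainsCopy {W V : Type*} (Gp : SimpleGraph W) (Γ : SimpleGraph V) : Prop :=
  ∃ f : W → V, Function.Injective f ∧ ∀ u v : W, Gp.Adj u v → Γ.Adj (f u) (f v)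

/-- The number of copies of `Gp` in `Γ`: subgraphs of `Γ` isomorphic to `Gp`. -/
noncomputable def numCopies {W V : Type*} (Gp : SimpleGraph W) (Γ : SimpleGraph V) : ℕ :=
  Nat.card {H : Γ.Subgraph // Nonempty (Gp ≃g H.coe)}

/-- The matched tuples of chosen vertices induce a partial isomorphism. -/
def PartialIso {V W : Type*} (G : SimpleGraph V) (H : SimpleGraph W)
    (xs : List V) (ys : List W) : Prop :=
  ∃ h : xs.length = ys.length,
    ∀ j k : Fin xs.length,
      (xs.get j = xs.get k ↔ ys.get (Fin.cast h j) = ys.get (Fin.cast h k)) ∧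
      (G.Adj (xs.get j) (xs.get k) ↔ H.Adj (ys.get (Fin.cast h j)) (ys.get (Fin.cast h k)))

/-- Duplicator has a winning strategy in the remaining `i` rounds of the Ehrenfeucht game
on `(G,H)` from the position given by the already chosen vertices `xs`, `ys`. -/
def DuplicatorWinsFrom {V W : Type*} (G : SimpleGraph V) (H : SimpleGraph W) :
    ℕ → List V → List W → Prop
  | 0, xs, ys => PartialIso G H xs ys
  | (i + 1), xs, ys =>
      (∀ x : V, ∃ y : W, DuplicatorWinsFrom G H i (x :: xs) (y :: ys)) ∧
      (∀ y : W, ∃ x : V, DuplicatorWinsFrom G H i (x :: xs) (y :: ys))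

/-- Duplicator has a winning strategy in the Ehrenfeucht game `EHR(G,H,i)`. -/
def DuplicatorWins {V W : Type*} (G : SimpleGraph V) (H : SimpleGraph W) (i : ℕ) : Prop :=
  DuplicatorWinsFrom G H i [] []

end RandomGraphSpectra

namespace RandomGraphSpectra

/-- The class `𝒮` of graphs from Section "Properties which imply the existence of
Duplicator's winning strategy" (properties 1)–3)). -/
def GoodGraph (k b : ℕ) (α : ℝ) {V : Type*} (Γ : SimpleGraph V) : Prop :=
  -- 1) no strictly balanced subgraph with at most `2^{2k}·b` vertices and density `> 1/α`
  (∀ A : Γ.Subgraph, Nat.card A.verts ≤ 2 ^ (2 * k) * b → StrictlyBalanced A.coe →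
      density A.coe ≤ 1 / α) ∧
  -- 2) strict extensions of α-safe pairs which are `(K₁,K₂)`-maximal
  (∀ (l h : ℕ) (H₁ : SimpleGraph (Fin l)) (H₂ : H₁.Subgraph) (r : Fin h → Fin l),
      Function.Injective r → Set.range r = H₂.verts →
      l ≤ 2 ^ (2 * k) * b + k * 2 ^ k → AlphaSafe α H₁ H₂ →
      ∀ x : Fin h → V, Function.Injective x →
        ∃ f : Fin l → V, IsStrictExtension H₁ H₂ r Γ x f ∧
          ∀ (u t : ℕ) (K₁ : SimpleGraph (Fin u)) (K₂ : K₁.Subgraph) (s : Fin t → Fin u),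
            Function.Injective s → Set.range s = K₂.verts →
            u ≤ 2 ^ k → Nat.card K₂.verts ≤ 2 → fAlpha α (⊤ : K₁.Subgraph) K₂ < 0 →
            PairMaximal K₁ K₂ s Γ (Set.range f) (Set.range x)) ∧
  -- 3) maximal copies of sparse strictly balanced graphs
  (∀ (w : ℕ) (Hp : SimpleGraph (Fin w)), w ≤ 2 ^ (2 * k) * b → StrictlyBalanced Hp →
      density Hp < 1 / α →
      ∃ f : Fin w → V, Function.Injective f ∧
        (∀ u v : Fin w, Hp.Adj u v → Γ.Adj (f u) (f v)) ∧
        ∀ (u t : ℕ) (K₁ : SimpleGraph (Fin u)) (K₂ : K₁.Subgraph) (s : Fin t → Fin u),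
          Function.Injective s → Set.range s = K₂.verts →
          u ≤ 2 ^ k → Nat.card K₂.verts ≤ 2 → fAlpha α (⊤ : K₁.Subgraph) K₂ < 0 →
          GraphMaximal K₁ K₂ s Γ (Set.range f))

end RandomGraphSpectra

namespace ZOK

set_option linter.unusedSectionVars false

section Comb
variable {V : Type*} [DecidableEq V] {G : SimpleGraph V}

open Classical in
/-- Number of edges of `G` inside the finite set `S`. -/
noncomputable def ed (G : SimpleGraph V) (S : Finset V) : ℕ :=
  ((S.sym2).filter (fun z => z ∈ G.edgeSet)).card

/-- `C` has no dense extension with at most `r - 2` new vertices. -/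
def Closed (G : SimpleGraph V) (r : ℕ) (C : Finset V) : Prop :=
  ∀ U : Finset V, Disjoint U C → U.card + 2 ≤ r → ed G (C ∪ U) ≤ ed G C + U.card

/-- `x` is at distance at least `h` from `C` and sees no short lollipop. -/
def Clean (G : SimpleGraph V) (h : ℕ) (C : Finset V) (x : V) : Prop :=
  ∀ B : Finset V, x ∈ B → Disjoint B C → B.card + 1 ≤ h → ed G (C ∪ B) < ed G C + B.card

/-- There is a walk of length exactly `n`. -/
def HW (G : SimpleGraph V) (n : ℕ) (x y : V) : Prop := ∃ w : G.Walk x y, w.length = n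

lemma HW.symm {n : ℕ} {x y : V} (h : HW G n x y) : HW G n y x := by
  obtain ⟨w, hw⟩ := h
  exact ⟨w.reverse, by simpa using hw⟩

lemma HW.trans {n m : ℕ} {x y z : V} (h : HW G n x y) (h' : HW G m y z) : HW G (n + m) x z := by
  obtain ⟨w, hw⟩ := h
  obtain ⟨w', hw'⟩ := h'
  exact ⟨w.append w', by simp [hw, hw']⟩

lemma HW.split {n m : ℕ} {x z : V} (h : HW G (n + m) x z) : ∃ y, HW G n x y ∧ HW G m y z := by
  obtain ⟨w, hw⟩ := h
  refine ⟨w.getVert n, ⟨w.take n, ?_⟩, ⟨w.drop n, ?_⟩⟩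
  · rw [SimpleGraph.Walk.take_length]; omega
  · rw [SimpleGraph.Walk.drop_length]; omega

lemma ed_empty : ed G ∅ = 0 := by simp [ed]

lemma ed_mono {S T : Finset V} (h : S ⊆ T) : ed G S ≤ ed G T := by
  classical
  unfold ed
  apply Finset.card_le_card
  apply Finset.filter_subset_filter
  exact Finset.sym2_mono h

lemma ed_super (A B : Finset V) : ed G A + ed G B ≤ ed G (A ∪ B) + ed G (A ∩ B) := by
  classical
  unfold ed
  rw [← Finset.card_union_add_card_inter]
  apply Nat.add_le_add
  · apply Finset.card_le_card
    intro z
    simp only [Finset.mem_union, Finset.mem_filter, Finset.mem_sym2_iff]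
    rintro (⟨h1, h2⟩ | ⟨h1, h2⟩)
    · exact ⟨fun a ha => Or.inl (h1 a ha), h2⟩
    · exact ⟨fun a ha => Or.inr (h1 a ha), h2⟩
  · apply Finset.card_le_card
    intro z
    simp only [Finset.mem_inter, Finset.mem_filter, Finset.mem_sym2_iff]
    rintro ⟨⟨h1, h2⟩, h3, -⟩
    exact ⟨fun a ha => ⟨h1 a ha, h3 a ha⟩, h2⟩

lemma ed_singleton (x : V) : ed G {x} = 0 := by
  classical
  unfold ed
  rw [Finset.card_eq_zero, Finset.filter_eq_empty_iff]
  intro z hz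
  induction z with | _ a b => ?_
  simp only [Finset.mem_sym2_iff, Sym2.mem_iff, Finset.mem_singleton] at hz
  have h1 := hz a (Or.inl rfl)
  have h2 := hz b (Or.inr rfl)
  subst h1 h2
  simp

/-- no edges between: additive -/
lemma ed_union_le {A B : Finset V} (h : ∀ a ∈ A, ∀ b ∈ B, ¬ G.Adj a b) :
    ed G (A ∪ B) ≤ ed G A + ed G B := by
  classical
  unfold ed
  refine le_trans (Finset.card_le_card ?_) (Finset.card_union_le _ _)
  intro z
  induction z with | _ a b => ?_
  simp only [Finset.mem_union, Finset.mem_filter, Finset.mem_sym2_iff, Sym2.mem_iff,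
    SimpleGraph.mem_edgeSet, forall_eq_or_imp, forall_eq]
  rintro ⟨⟨h1, h2⟩, h3⟩
  have := h a
  have := h b
  have := h3.symm
  grind

lemma ed_edges_le {A B : Finset V} (hAB : Disjoint A B) (F : Finset (Sym2 V))
    (hF : ∀ z ∈ F, ∃ a ∈ A, ∃ b ∈ B, G.Adj a b ∧ z = s(a, b)) :
    ed G A + ed G B + F.card ≤ ed G (A ∪ B) := by
  classical
  unfold ed
  have d1 : Disjoint ((A.sym2).filter (fun z => z ∈ G.edgeSet)) ((B.sym2).filter (fun z => z ∈ G.edgeSet)) := by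
    rw [Finset.disjoint_left]
    intro z
    induction z with | _ a b => ?_
    simp only [Finset.mem_filter, Finset.mem_sym2_iff, Sym2.mem_iff, forall_eq_or_imp, forall_eq]
    rintro ⟨⟨h1, h2⟩, h3⟩ ⟨⟨h4, h5⟩, h6⟩
    exact Finset.disjoint_left.1 hAB h1 h4
  have d2 : Disjoint (((A.sym2).filter (fun z => z ∈ G.edgeSet)) ∪ ((B.sym2).filter (fun z => z ∈ G.edgeSet))) F := by
    rw [Finset.disjoint_left]
    intro z hz hzF
    obtain ⟨a, ha, b, hb, hab, rfl⟩ := hF z hzF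
    simp only [Finset.mem_union, Finset.mem_filter, Finset.mem_sym2_iff, Sym2.mem_iff, forall_eq_or_imp, forall_eq] at hz
    rcases hz with ⟨⟨h1, h2⟩, h3⟩ | ⟨⟨h1, h2⟩, h3⟩
    · exact Finset.disjoint_left.1 hAB h2 hb
    · exact Finset.disjoint_left.1 hAB ha h1
  rw [← Finset.card_union_of_disjoint d1, ← Finset.card_union_of_disjoint d2]
  apply Finset.card_le_card
  intro z hz
  simp only [Finset.mem_union] at hz
  rcases hz with (hz | hz) | hz
  · simp only [Finset.mem_filter, Finset.mem_sym2_iff] at hz ⊢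
    exact ⟨fun a ha => Finset.mem_union_left _ (hz.1 a ha), hz.2⟩
  · simp only [Finset.mem_filter, Finset.mem_sym2_iff] at hz ⊢
    exact ⟨fun a ha => Finset.mem_union_right _ (hz.1 a ha), hz.2⟩
  · obtain ⟨a, ha, b, hb, hab, rfl⟩ := hF z hz
    simp only [Finset.mem_filter, Finset.mem_sym2_iff, Sym2.mem_iff, forall_eq_or_imp, forall_eq, SimpleGraph.mem_edgeSet]
    exact ⟨⟨Finset.mem_union_left _ ha, Finset.mem_union_right _ hb⟩, hab⟩

lemma ed_disj_le {A B : Finset V} (hAB : Disjoint A B) : ed G A + ed G B ≤ ed G (A ∪ B) := by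
  simpa using ed_edges_le (G := G) hAB ∅ (by simp)

lemma ed_one_le {A B : Finset V} (hAB : Disjoint A B) {a b : V} (ha : a ∈ A) (hb : b ∈ B)
    (h : G.Adj a b) : ed G A + ed G B + 1 ≤ ed G (A ∪ B) := by
  simpa using ed_edges_le (G := G) hAB {s(a, b)} (by
    intro z hz
    exact ⟨a, ha, b, hb, h, by simpa using hz⟩)

lemma ed_two_le {A B : Finset V} (hAB : Disjoint A B) {a b a' b' : V} (ha : a ∈ A) (hb : b ∈ B)
    (h : G.Adj a b) (ha' : a' ∈ A) (hb' : b' ∈ B) (h' : G.Adj a' b') (hne : b ≠ b') :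
    ed G A + ed G B + 2 ≤ ed G (A ∪ B) := by
  have h1 := ed_edges_le (G := G) hAB {s(a, b), s(a', b')} (by
    intro z hz
    simp only [Finset.mem_insert, Finset.mem_singleton] at hz
    rcases hz with rfl | rfl
    · exact ⟨a, ha, b, hb, h, rfl⟩
    · exact ⟨a', ha', b', hb', h', rfl⟩)
  rw [Finset.card_pair] at h1
  · exact h1
  · intro he
    rw [Sym2.eq_iff] at he
    rcases he with ⟨-, h2⟩ | ⟨h2, -⟩
    · exact hne h2
    · exact Finset.disjoint_left.1 hAB ha (h2 ▸ hb')

lemma ed_map {U : Type*} [DecidableEq U] (u : U ↪ V) (S : Finset U) :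
    ed G (S.map u) = ed (G.comap u) S := by
  classical
  unfold ed
  rw [← Finset.card_map (⟨Sym2.map u, Sym2.map.injective u.injective⟩ : Sym2 U ↪ Sym2 V)]
  congr 1
  ext z
  induction z with | _ a b => ?_
  simp only [Finset.mem_filter, Finset.mem_sym2_iff, Finset.mem_map, Sym2.mem_iff, forall_eq_or_imp, forall_eq, Function.Embedding.coeFn_mk]
  constructor
  · rintro ⟨⟨⟨x, hx, rfl⟩, ⟨y, hy, rfl⟩⟩, h⟩
    exact ⟨s(x, y), ⟨by simp [hx, hy], by simpa using h⟩, by simp⟩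
  · rintro ⟨z, ⟨h1, h2⟩, h3⟩
    induction z with | _ x y => ?_
    simp only [Sym2.mem_iff, forall_eq_or_imp, forall_eq] at h1
    simp only [Sym2.map_mk] at h3
    have h4 : s(a, b) ∈ G.edgeSet := by rw [← h3]; simpa using h2
    refine ⟨?_, h4⟩
    rw [Sym2.eq_iff] at h3
    rcases h3 with ⟨rfl, rfl⟩ | ⟨rfl, rfl⟩
    · exact ⟨⟨x, h1.1, rfl⟩, ⟨y, h1.2, rfl⟩⟩
    · exact ⟨⟨y, h1.2, rfl⟩, ⟨x, h1.1, rfl⟩⟩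

lemma Closed.mono {r r' : ℕ} {C : Finset V} (h : Closed G r C) (hr : r' ≤ r) : Closed G r' C :=
  fun U hU hc => h U hU (le_trans hc hr)

lemma closed_add {r r' : ℕ} {C T : Finset V} (h : Closed G r C) (hT : Disjoint T C)
    (he : ed G C + T.card ≤ ed G (C ∪ T)) (hr : r' + T.card ≤ r) : Closed G r' (C ∪ T) := by
  intro U hU hc
  have hU1 : Disjoint U T := Finset.disjoint_of_subset_right Finset.subset_union_right hU
  have hU2 : Disjoint U C := Finset.disjoint_of_subset_right Finset.subset_union_left hU
  have h1 := h (T ∪ U) (by rw [Finset.disjoint_union_left]; exact ⟨hT, hU2⟩)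
    (by rw [Finset.card_union_of_disjoint hU1.symm]; omega)
  rw [Finset.card_union_of_disjoint hU1.symm, ← Finset.union_assoc] at h1
  omega

/-- relative supermodularity -/
lemma ed_rel {A B C : Finset V} :
    ed G (C ∪ A) + ed G (C ∪ B) ≤ ed G (C ∪ (A ∪ B)) + ed G (C ∪ (A ∩ B)) := by
  have := ed_super (G := G) (C ∪ A) (C ∪ B)
  rw [← Finset.union_union_distrib_left, ← Finset.union_inter_distrib_left] at this
  exact this

lemma ed_rel_mono {C D S : Finset V} (hCD : C ⊆ D) (hS : Disjoint S D) :
    ed G (C ∪ S) + ed G D ≤ ed G (D ∪ S) + ed G C := by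
  have := ed_super (G := G) (C ∪ S) D
  have e1 : C ∪ S ∪ D = D ∪ S := by
    ext z; simp only [Finset.mem_union]
    have := @hCD z
    tauto
  have e2 : (C ∪ S) ∩ D = C := by
    ext z; simp only [Finset.mem_union, Finset.mem_inter]
    have := @hCD z
    have h9 : z ∈ S → z ∉ D := fun h => Finset.disjoint_left.1 hS h
    tauto
  rw [e1, e2] at this
  exact this

lemma link {D : Finset V} {a d : V} (w : G.Walk a d) :
    ∀ {A : Finset V}, a ∈ A → d ∈ D → Disjoint A D →
    ∃ B, A ⊆ B ∧ Disjoint B D ∧ ed G A + B.card ≤ ed G B + A.card ∧ ∃ b ∈ B, ∃ d' ∈ D, G.Adj b d' ∧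
      ((B.card + 1 ≤ A.card + w.length ∧ d' = d) ∨ B.card + 2 ≤ A.card + w.length) := by
  induction w with
  | nil => intro A ha hd hAD; exact absurd hd (Finset.disjoint_left.1 hAD ha)
  | @cons a v d h p ih =>
    intro A ha hd hAD
    simp only [SimpleGraph.Walk.length_cons]
    by_cases hvD : v ∈ D
    · refine ⟨A, subset_rfl, hAD, le_rfl, a, ha, v, hvD, h, ?_⟩
      by_cases hvd : v = d
      · left; exact ⟨by omega, hvd⟩
      · right
        have : p.length ≠ 0 := fun h0 => hvd (SimpleGraph.Walk.eq_of_length_eq_zero h0)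
        omega
    by_cases hvA : v ∈ A
    · obtain ⟨B, h1, h2, h3, b, hb, d', hd', h4, h5⟩ := ih hvA hd hAD
      refine ⟨B, h1, h2, h3, b, hb, d', hd', h4, ?_⟩
      right
      rcases h5 with ⟨h5, -⟩ | h5 <;> omega
    · have hdis : Disjoint ({v} : Finset V) A := by simpa using hvA
      have hdis2 : Disjoint (A ∪ {v}) D := by
        rw [Finset.disjoint_union_left]; exact ⟨hAD, by simpa using hvD⟩
      obtain ⟨B, h1, h2, h3, b, hb, d', hd', h4, h5⟩ := ih (A := A ∪ {v}) (by simp) hd hdis2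
      have hc : (A ∪ {v}).card = A.card + 1 := by
        rw [Finset.card_union_of_disjoint hdis.symm]; simp
      have he := ed_one_le (G := G) hdis.symm ha (Finset.mem_singleton_self v) h
      rw [ed_singleton] at he
      refine ⟨B, Finset.subset_union_left.trans h1, h2, by omega, b, hb, d', hd', h4, ?_⟩
      rcases h5 with ⟨h5, h6⟩ | h5
      · left; exact ⟨by omega, h6⟩
      · right; omega

lemma not_mem_of_disj_singleton {x : V} {B : Finset V} (h : x ∉ B) : Disjoint ({x} : Finset V) B := by
  simpa using h

/-- from a clean vertex, walks to `D` have length at least `h`. -/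
lemma Clean.le_length {h n : ℕ} {D : Finset V} {z d : V} (hz : z ∉ D) (hc : Clean G h D z)
    (hw : HW G n z d) (hd : d ∈ D) : h ≤ n := by
  obtain ⟨w, rfl⟩ := hw
  by_contra hlt
  obtain ⟨B, h1, h2, h3, b, hb, d', hd', h4, h5⟩ :=
    link w (Finset.mem_singleton_self z) hd (not_mem_of_disj_singleton hz)
  have hzB : z ∈ B := h1 (Finset.mem_singleton_self z)
  simp only [Finset.card_singleton, ed_singleton] at h3 h5
  have h6 := hc B hzB h2 (by rcases h5 with ⟨h5, -⟩ | h5 <;> omega)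
  have h7 := ed_one_le (G := G) h2 hb hd' h4
  rw [Finset.union_comm] at h7
  omega

lemma Clean.one_target {h : ℕ} {D : Finset V} {z p : V} (hz : z ∉ D) (hc : Clean G h D z)
    (hw : HW G h z p) (hp : p ∈ D) :
    ∃ B, z ∈ B ∧ Disjoint B D ∧ B.card = h ∧ B.card ≤ ed G B + 1 ∧ ∃ b ∈ B, G.Adj b p := by
  obtain ⟨w, rfl⟩ := hw
  obtain ⟨B, h1, h2, h3, b, hb, d', hd', h4, h5⟩ :=
    link w (Finset.mem_singleton_self z) hp (not_mem_of_disj_singleton hz)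
  have hzB : z ∈ B := h1 (Finset.mem_singleton_self z)
  simp only [Finset.card_singleton, ed_singleton] at h3 h5
  have h7 := ed_one_le (G := G) h2 hb hd' h4
  rw [Finset.union_comm] at h7
  have key : ¬ (B.card + 1 ≤ w.length) := by
    intro h8
    have := hc B hzB h2 h8
    omega
  rcases h5 with ⟨h5, rfl⟩ | h5
  · exact ⟨B, hzB, h2, by omega, by omega, b, hb, h4⟩
  · omega

lemma Clean.two_target {h : ℕ} {D : Finset V} {z p q : V} (hz : z ∉ D) (hc : Clean G h D z)
    (hp : p ∈ D) (hq : q ∈ D) (hpq : p ≠ q) (hwp : HW G h z p) (hwq : HW G h z q) :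
    ∃ B, z ∈ B ∧ Disjoint B D ∧ B.card + 1 ≤ 2 * h ∧
      ∀ C ⊆ D, p ∈ C → q ∈ C → ed G C + B.card + 1 ≤ ed G (C ∪ B) := by
  obtain ⟨B1, hz1, hd1, hc1, he1, b1, hb1, ha1⟩ := hc.one_target hz hwp hp
  obtain ⟨B2, hz2, hd2, hc2, he2, b2, hb2, ha2⟩ := hc.one_target hz hwq hq
  have hpos : 0 < B1.card := Finset.card_pos.2 ⟨z, hz1⟩
  by_cases hBB : B1 = B2
  · subst hBB
    refine ⟨B1, hz1, hd1, by omega, fun C hCD hpC hqC => ?_⟩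
    have := ed_two_le (G := G) (Finset.disjoint_of_subset_right hCD hd1) hb1 hpC ha1 hb2 hqC ha2 hpq
    rw [Finset.union_comm] at this
    omega
  · have hlt : (B1 ∩ B2).card < B1.card := by
      apply Finset.card_lt_card
      rw [Finset.ssubset_iff_subset_ne]
      refine ⟨Finset.inter_subset_left, fun h0 => hBB ?_⟩
      apply Finset.eq_of_subset_of_card_le
      · rw [← h0]; exact Finset.inter_subset_right
      · omega
    have hzi : z ∈ B1 ∩ B2 := Finset.mem_inter.2 ⟨hz1, hz2⟩
    have hposi : 0 < (B1 ∩ B2).card := Finset.card_pos.2 ⟨z, hzi⟩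
    have hcu := Finset.card_union_add_card_inter B1 B2
    refine ⟨B1 ∪ B2, Finset.mem_union_left _ hz1, Finset.disjoint_union_left.2 ⟨hd1, hd2⟩, by omega,
      fun C hCD hpC hqC => ?_⟩
    have hdi : Disjoint (B1 ∩ B2) D := Finset.disjoint_of_subset_left Finset.inter_subset_left hd1
    have hcl := hc (B1 ∩ B2) hzi hdi (by omega)
    have hrm := ed_rel_mono (G := G) hCD hdi
    have e1 := ed_one_le (G := G) (Finset.disjoint_of_subset_right hCD hd1) hb1 hpC ha1
    have e2 := ed_one_le (G := G) (Finset.disjoint_of_subset_right hCD hd2) hb2 hqC ha2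
    rw [Finset.union_comm] at e1 e2
    have e3 := ed_rel (G := G) (A := B1) (B := B2) (C := C)
    omega

/-- dichotomy for a non-clean vertex -/
lemma not_clean {s : ℕ} {D B : Finset V} {x : V} (hD : Closed G (s + 1) D) (hx : x ∈ B)
    (hB : Disjoint B D) (hs : B.card ≤ s) (he : ed G D + B.card ≤ ed G (D ∪ B)) :
    (∃ K, x ∈ K ∧ K ⊆ B ∧ K.card ≤ ed G K) ∨ (∃ d ∈ D, ∃ n ≤ B.card, HW G n x d) := by
  classical
  set K : Finset V := B.filter (fun z => ∃ w : G.Walk x z, ∀ y ∈ w.support, y ∈ B) with hK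
  have hxK : x ∈ K := by
    rw [hK, Finset.mem_filter]
    exact ⟨hx, SimpleGraph.Walk.nil, by simpa using hx⟩
  have hKB : K ⊆ B := Finset.filter_subset _ _
  by_cases hKD : ∃ z ∈ K, ∃ d ∈ D, G.Adj z d
  · right
    obtain ⟨z, hz, d, hd, hzd⟩ := hKD
    rw [hK, Finset.mem_filter] at hz
    obtain ⟨hzB, w, hw⟩ := hz
    refine ⟨d, hd, w.bypass.length + 1, ?_, ⟨w.bypass.concat hzd, by simp⟩⟩
    have h1 : w.bypass.support.toFinset ⊆ B := by
      intro y hy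
      exact hw y (w.support_bypass_subset_support (List.mem_toFinset.1 hy))
    have h2 := Finset.card_le_card h1
    rw [List.toFinset_card_of_nodup w.bypass_isPath.support_nodup, SimpleGraph.Walk.length_support] at h2
    exact h2
  · left
    push Not at hKD
    refine ⟨K, hxK, hKB, ?_⟩
    have hsplit : D ∪ B = K ∪ (D ∪ (B \ K)) := by
      ext z; simp only [Finset.mem_union, Finset.mem_sdiff]
      have := @hKB z
      tauto
    have h1 : ed G (D ∪ B) ≤ ed G K + ed G (D ∪ (B \ K)) := by
      rw [hsplit]
      apply ed_union_le
      intro a ha b hb hab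
      rw [Finset.mem_union] at hb
      rcases hb with hb | hb
      · exact hKD a ha b hb hab
      · rw [Finset.mem_sdiff] at hb
        apply hb.2
        rw [hK, Finset.mem_filter] at ha ⊢
        obtain ⟨haB, w, hw⟩ := ha
        refine ⟨hb.1, w.concat hab, ?_⟩
        intro y hy
        rw [SimpleGraph.Walk.support_concat, List.mem_append] at hy
        rcases hy with hy | hy
        · exact hw y hy
        · rw [List.mem_singleton] at hy; rw [hy]; exact hb.1
    have hcard := Finset.card_sdiff_add_card_eq_card hKB
    have hKpos : 0 < K.card := Finset.card_pos.2 ⟨x, hxK⟩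
    have h2 := hD (B \ K) (Finset.disjoint_of_subset_left Finset.sdiff_subset hB) (by omega)
    omega

end Comb

end ZOK

namespace ZOK

set_option linter.unusedSectionVars false

section Good
variable {V : Type} [DecidableEq V] {G : SimpleGraph V}

/-- numerical parameters -/
structure Par (M P Q a b : ℕ) : Prop where
  hM : 2 ≤ M
  hP : P = M * b + a
  hQ : Q + b = P
  ha : 1 ≤ a
  hb : 1 ≤ b
  hab : M ≤ a + b
  hco : Nat.Coprime P b

/-- The deterministic properties used by Duplicator. -/
structure Good (M P Q B : ℕ) (G : SimpleGraph V) : Prop where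
  w1 : ∀ S : Finset V, S.card ≤ B → Q * ed G S ≤ P * S.card
  w2 : ∀ v : V, ∀ S : Finset V, S.card ≤ B → ∃ w, w ∉ S ∧ G.Adj v w
  w3 : ∀ s ≤ B, ∀ H : SimpleGraph (Fin s),
    (∀ S : Finset (Fin s), S.Nonempty → Q * ed H S < P * S.card) →
    ∃ φ : Fin s ↪ V, H ≤ G.comap φ ∧ ∀ U : Finset V, Disjoint U (Finset.univ.map φ) →
      U.card + 1 ≤ M → ed G (Finset.univ.map φ ∪ U) ≤ ed H Finset.univ + U.card

lemma Par.coQ {M P Q a b : ℕ} (hp : Par M P Q a b) : Nat.Coprime P Q := by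
  have h := hp.hco
  have h2 := hp.hQ
  have : Nat.Coprime (Q + b) b := by rw [h2]; exact h
  have h3 : Nat.Coprime Q b := by simpa using this
  rw [← h2]
  have : Nat.Coprime (Q + b) Q := by
    rw [add_comm]; simpa using h3.symm
  exact this

lemma Par.Qpos {M P Q a b : ℕ} (hp : Par M P Q a b) : M ≤ Q := by
  have h1 := hp.hQ
  have h2 := hp.hP
  have h3 := hp.hab
  have h4 := hp.hM
  have h5 := hp.hb
  obtain ⟨m, rfl⟩ : ∃ m, M = m + 2 := ⟨M - 2, by omega⟩
  have : (m+2) * b = m * b + 2 * b := by ring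
  have : m ≤ m * b := Nat.le_mul_of_pos_right m h5
  have := hp.ha
  omega

lemma eq_of_ed_le {H H' : SimpleGraph V} (hle : H ≤ H') {S : Finset V}
    (he : ed H' S ≤ ed H S) {a b : V} (ha : a ∈ S) (hb : b ∈ S) (h : H'.Adj a b) : H.Adj a b := by
  classical
  unfold ed at he
  have hsub : (S.sym2).filter (fun z => z ∈ H.edgeSet) ⊆ (S.sym2).filter (fun z => z ∈ H'.edgeSet) := by
    intro z hz
    rw [Finset.mem_filter] at hz ⊢
    exact ⟨hz.1, SimpleGraph.edgeSet_mono hle hz.2⟩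
  have heq := Finset.eq_of_subset_of_card_le hsub he
  have : s(a, b) ∈ (S.sym2).filter (fun z => z ∈ H'.edgeSet) := by
    rw [Finset.mem_filter]
    refine ⟨?_, by simpa using h⟩
    simp [ha, hb]
  rw [← heq, Finset.mem_filter] at this
  simpa using this.2

lemma Good.w3' {M P Q a b B : ℕ} (hp : Par M P Q a b) (g : Good M P Q B G)
    {ι : Type} [Fintype ι] [DecidableEq ι] (hc : Fintype.card ι ≤ B) (H : SimpleGraph ι)
    (hH : ∀ S : Finset ι, S.Nonempty → Q * ed H S < P * S.card) :
    ∃ φ : ι ↪ V, H = G.comap φ ∧ Closed G (M + 1) (Finset.univ.map φ) := by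
  classical
  let e := Fintype.equivFin ι
  obtain ⟨φ, h1, h2⟩ := g.w3 _ hc (H.comap e.symm) (by
    intro S hS
    have := hH (S.map e.symm.toEmbedding) (by simpa using hS)
    rw [ed_map] at this
    simpa using this)
  have hcl := h2 ∅ (by simp) (by simp; exact le_trans (by norm_num) hp.hM)
  simp only [Finset.union_empty, Finset.card_empty, add_zero] at hcl
  rw [ed_map] at hcl
  have heq : ∀ a b, (G.comap φ).Adj a b → (H.comap e.symm).Adj a b := fun a b hab =>
    eq_of_ed_le h1 hcl (Finset.mem_univ a) (Finset.mem_univ b) hab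
  have hrange : Finset.univ.map (e.toEmbedding.trans φ) = Finset.univ.map φ := by
    rw [← Finset.map_map]; congr 1; ext; simp
  refine ⟨e.toEmbedding.trans φ, ?_, ?_⟩
  · ext a b
    have hl := @h1 (e a) (e b)
    have hr := heq (e a) (e b)
    simp only [SimpleGraph.comap_adj, Equiv.symm_apply_apply] at hl hr
    simp only [SimpleGraph.comap_adj, Function.Embedding.trans_apply, Equiv.coe_toEmbedding]
    exact ⟨hl, hr⟩
  · rw [hrange]
    intro U hU hUc
    have h3 := h2 U hU (by omega)
    have h4 : ed (H.comap e.symm) Finset.univ ≤ ed G (Finset.univ.map φ) := by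
      rw [ed_map]
      apply Finset.card_le_card
      intro z hz
      rw [Finset.mem_filter] at hz ⊢
      exact ⟨hz.1, SimpleGraph.edgeSet_mono h1 hz.2⟩
    omega

lemma Good.closure {M P Q a b B : ℕ} (hp : Par M P Q a b) (g : Good M P Q B G) {r : ℕ} (hr : r + 1 ≤ M) :
    ∀ (F : ℕ) (C : Finset V), P * C.card = Q * ed G C + F → C.card + M * F + M ≤ B →
    ∃ D, C ⊆ D ∧ Closed G (r + 2) D ∧ D.card ≤ C.card + M * F ∧
      (r + 1) * D.card + r * ed G C ≤ (r + 1) * C.card + r * ed G D := by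
  intro F
  induction F using Nat.strong_induction_on with
  | _ F ih =>
  intro C hF hB
  by_cases hcl : Closed G (r + 2) C
  · exact ⟨C, subset_rfl, hcl, by omega, le_rfl⟩
  unfold Closed at hcl
  push Not at hcl
  obtain ⟨U, hU, hUc, hUe⟩ := hcl
  have hcard : (C ∪ U).card = C.card + U.card := Finset.card_union_of_disjoint hU.symm
  have hw := g.w1 (C ∪ U) (by rw [hcard]; omega)
  rw [hcard] at hw
  obtain ⟨e, he⟩ : ∃ e, ed G (C ∪ U) = ed G C + U.card + 1 + e := ⟨_, (Nat.add_sub_of_le hUe).symm⟩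
  obtain ⟨m, hm⟩ : ∃ m, M = U.card + 1 + m := ⟨M - (U.card + 1), by omega⟩
  have hP := hp.hP
  have hQ := hp.hQ
  have hlt : F ≠ 0 ∧ P * (C.card + U.card) < Q * ed G (C ∪ U) + F := by
    have key : P * (C.card + U.card) + a ≤ Q * ed G (C ∪ U) + F := by
      rw [he]
      have : P * U.card + a ≤ Q * (U.card + 1) := by
        have e1 : Q * (U.card + 1) + b * (U.card + 1) = P * U.card + P := by rw [← hQ]; ring
        have e2 : P = b * (U.card + 1) + m * b + a := by rw [hP, hm]; ring
        omega
      have : Q * (ed G C + U.card + 1 + e) = Q * ed G C + Q * (U.card + 1) + Q * e := by ring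
      have : P * (C.card + U.card) = P * C.card + P * U.card := by ring
      omega
    have := hp.ha
    omega
  obtain ⟨F', hF'⟩ : ∃ F', P * (C.card + U.card) = Q * ed G (C ∪ U) + F' :=
    ⟨_, (Nat.add_sub_of_le hw).symm⟩
  have hFF : F' + 1 ≤ F := by omega
  have hMF : M * F' + M ≤ M * F := by
    calc M * F' + M = M * (F' + 1) := by ring
      _ ≤ _ := Nat.mul_le_mul_left _ hFF
  obtain ⟨D, h1, h2, h3, h4⟩ := ih F' (by omega) (C ∪ U) (by rw [hcard]; exact hF') (by rw [hcard]; omega)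
  refine ⟨D, Finset.subset_union_left.trans h1, h2, by omega, ?_⟩
  rw [hcard, he] at h4
  have e1 : (r + 1) * (C.card + U.card) = (r + 1) * C.card + r * U.card + U.card := by ring
  have e2 : r * (ed G C + U.card + 1 + e) = r * ed G C + r * U.card + r + r * e := by ring
  have : r * ed G C ≤ r * ed G D := Nat.mul_le_mul_left _ (ed_mono (Finset.subset_union_left.trans h1))
  omega

lemma Good.closure' {M P Q a b B : ℕ} (hp : Par M P Q a b) (g : Good M P Q B G) (C : Finset V)
    (hB : C.card + M * (P * C.card) + M ≤ B) :
    ∃ D, C ⊆ D ∧ Closed G (M + 1) D ∧ D.card ≤ C.card + M * (P * C.card) := by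
  have hw := g.w1 C (by omega)
  obtain ⟨F, hF⟩ : ∃ F, P * C.card = Q * ed G C + F := ⟨_, (Nat.add_sub_of_le hw).symm⟩
  have hle : M * F ≤ M * (P * C.card) := Nat.mul_le_mul_left _ (by omega)
  have h2 := hp.hM
  obtain ⟨D, h1, h2, h3, -⟩ := g.closure hp (r := M - 1) (by omega) F C hF (by omega)
  exact ⟨D, h1, by convert h2 using 1; omega, by omega⟩

/-- small sets are strictly sparse -/
lemma Good.strict_small {M P Q a b B : ℕ} (hp : Par M P Q a b) (g : Good M P Q B G) {S : Finset V}
    (hS : S.Nonempty) (hSB : S.card ≤ B) (h : S.card < M ∨ ed G S < P) :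
    Q * ed G S < P * S.card := by
  have hw := g.w1 S hSB
  have hpos := Finset.card_pos.2 hS
  rcases Nat.lt_or_eq_of_le hw with h1 | h1
  · exact h1
  exfalso
  have hP : 0 < P := by have := hp.hQ; have := hp.hb; omega
  rcases h with h | h
  · have hd : Q ∣ P * S.card := ⟨_, h1.symm⟩
    have := hp.coQ.symm.dvd_of_dvd_mul_left hd
    have := Nat.le_of_dvd hpos this
    have := hp.Qpos
    omega
  · have hd : P ∣ Q * ed G S := ⟨_, h1⟩
    have h2 := hp.coQ.dvd_of_dvd_mul_left hd
    have h3 := Nat.eq_zero_of_dvd_of_lt h2 h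
    rw [h3, mul_zero] at h1
    have := Nat.mul_pos hP hpos
    omega

end Good

section Two
variable {V W : Type} [DecidableEq V] [DecidableEq W] {G : SimpleGraph V} {G' : SimpleGraph W}

/-- One-step copying lemma for the first round. -/
lemma first_copy {M P Q a b B : ℕ} (hp : Par M P Q a b) (g : Good M P Q B G) (g' : Good M P Q B G')
    (hB : 1 + M * P + M ≤ B) (x : V) :
    ∃ (C : Finset V) (v : C ↪ W), x ∈ C ∧ C.card ≤ 1 + M * P ∧ G.comap (fun z : C => (z : V)) = G'.comap v ∧
      Closed G M C ∧ Closed G' M (Finset.univ.map v) := by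
  classical
  have hM := hp.hM
  obtain ⟨m, rfl⟩ : ∃ m, M = m + 2 := ⟨M - 2, by omega⟩
  obtain ⟨C, h1, h2, h3, h4⟩ := g.closure hp (r := m) (by omega) P {x} (by simp [ed_singleton])
    (by simpa using hB)
  simp only [Finset.card_singleton, ed_singleton] at h3 h4
  have hCB : C.card ≤ B := by omega
  have hw := g.w1 C hCB
  have hlt : ed G C < P := by
    by_contra hge
    push Not at hge
    have hP := hp.hP
    have hQ := hp.hQ
    have hab := hp.hab
    have e1 : (m + 1) * (Q * ed G C) ≤ P * ((m + 1) * C.card) := by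
      calc (m + 1) * (Q * ed G C) ≤ (m + 1) * (P * C.card) := Nat.mul_le_mul_left _ hw
        _ = _ := by ring
    have e2 : P * ((m + 1) * C.card) ≤ P * ((m + 1) + m * ed G C) := Nat.mul_le_mul_left _ (by omega)
    have e3 : (m + 1) * (Q * ed G C) + (m + 1) * (b * ed G C) = (m + 1) * (P * ed G C) := by
      rw [← hQ]; ring
    have e4 : P * ((m + 1) + m * ed G C) + P * ed G C = (m + 1) * P + (m + 1) * (P * ed G C) := by ring
    have e5 : P * ed G C = (m + 1) * (b * ed G C) + (a + b) * ed G C := by rw [hP]; ring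
    have e6 : (m + 2) * ed G C ≤ (a + b) * ed G C := Nat.mul_le_mul_right _ hab
    have e7 : (m + 2) * P ≤ (m + 2) * ed G C := Nat.mul_le_mul_left _ hge
    have e8 : (m + 2) * P = (m + 1) * P + P := by ring
    have : 0 < P := by have := hp.hb; omega
    omega
  obtain ⟨v, hv, hv2⟩ := g'.w3' hp (ι := C) (by simpa using hCB) (G.comap (fun z : C => (z : V))) (by
    intro S hS
    have hm := ed_map (G := G) (Function.Embedding.subtype (· ∈ C)) S
    have hsub : S.map (Function.Embedding.subtype (· ∈ C)) ⊆ C := by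
      intro z hz
      rw [Finset.mem_map] at hz
      obtain ⟨y, -, rfl⟩ := hz
      exact y.2
    have := g.strict_small hp (S := S.map (Function.Embedding.subtype (· ∈ C))) (by simpa using hS)
      (le_trans (Finset.card_le_card hsub) hCB) (Or.inr (lt_of_le_of_lt (ed_mono hsub) hlt))
    rw [hm, Finset.card_map] at this
    exact this)
  exact ⟨C, v, h1 (by simp), by omega, hv, h2, hv2.mono (by omega)⟩

end Two

end ZOK

namespace ZOK

set_option linter.unusedSectionVars false

section Resp
variable {V : Type} [DecidableEq V] {G : SimpleGraph V}

lemma ed_insert_le {A : Finset V} {y u : V} (h : ∀ a ∈ A, G.Adj y a → a = u) :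
    ed G (A ∪ {y}) ≤ ed G A + 1 := by
  classical
  unfold ed
  have : (((A ∪ {y}).sym2).filter (fun z => z ∈ G.edgeSet)) ⊆
      ((A.sym2).filter (fun z => z ∈ G.edgeSet)) ∪ {s(y, u)} := by
    intro z
    induction z with | _ a b => ?_
    simp only [Finset.mem_union, Finset.mem_filter, Finset.mem_sym2_iff, Sym2.mem_iff,
      SimpleGraph.mem_edgeSet, forall_eq_or_imp, forall_eq, Finset.mem_singleton]
    rintro ⟨⟨h1, h2⟩, h3⟩
    rcases h1 with h1 | rfl
    · rcases h2 with h2 | rfl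
      · exact Or.inl ⟨⟨h1, h2⟩, h3⟩
      · right; rw [h a h1 h3.symm]; exact Sym2.eq_swap
    · rcases h2 with h2 | rfl
      · right; rw [h b h2 h3]
      · exact absurd h3 (G.irrefl)
  refine le_trans (Finset.card_le_card this) ?_
  refine le_trans (Finset.card_union_le _ _) ?_
  simp

lemma Closed.uniq {r : ℕ} {D : Finset V} (hD : Closed G r D) (hr : 3 ≤ r) {y u d : V} (hy : y ∉ D)
    (hu : u ∈ D) (hd : d ∈ D) (h1 : G.Adj y u) (h2 : G.Adj y d) : d = u := by
  by_contra hne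
  have h3 := hD {y} (by simpa using hy) (by simpa using hr)
  have h4 := ed_two_le (G := G) (A := {y}) (B := D) (by simpa using hy) (by simp) hu h1 (by simp) hd h2
    (fun h => hne h.symm)
  rw [Finset.union_comm, ed_singleton] at h4
  rw [Finset.card_singleton] at h3
  omega

lemma tail_path {M P Q B : ℕ} (g : Good M P Q B G) {D : Finset V} {u : V} (hu : u ∈ D)
    (hD : Closed G (M + 1) D) :
    ∀ t : ℕ, t + 3 ≤ M + 1 → D.card + t + 1 ≤ B → ∃ (T : Finset V) (y : V), T.card = t + 1 ∧ y ∈ T ∧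
      Disjoint T D ∧ HW G (t + 1) y u ∧ (∀ z ∈ T, ∀ d ∈ D, G.Adj z d → d = u) ∧
      (∀ C ⊆ D, u ∈ C → ed G C + (t + 1) ≤ ed G (C ∪ T)) ∧
      (∀ S ⊆ T, y ∈ S → S ≠ T → ed G (D ∪ S) < ed G D + S.card) := by
  intro t
  induction t with
  | zero =>
    intro hM hB
    obtain ⟨y, hy, hyu⟩ := g.w2 u D (by omega)
    refine ⟨{y}, y, by simp, by simp, by simpa using hy, ⟨SimpleGraph.Walk.cons hyu.symm .nil, rfl⟩, ?_, ?_, ?_⟩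
    · intro z hz d hd hzd
      rw [Finset.mem_singleton] at hz
      subst hz
      exact hD.uniq (by omega) hy hu hd hyu.symm hzd
    · intro C hC huC
      have := ed_one_le (G := G) (A := C) (B := {y}) (by simpa using fun h => hy (hC h)) huC (by simp) hyu
      rw [ed_singleton] at this
      omega
    · intro S hS hyS hne
      exfalso; apply hne
      apply Finset.Subset.antisymm hS
      simpa using hyS
  | succ t ih =>
    intro hM hB
    obtain ⟨T, y, hTc, hyT, hTD, hw, hadj, hden, hsp⟩ := ih (by omega) (by omega)
    have hcard : (D ∪ T).card = D.card + (t + 1) := by rw [Finset.card_union_of_disjoint hTD.symm, hTc]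
    obtain ⟨y', hy', hyy⟩ := g.w2 y (D ∪ T) (by omega)
    have hDT : Closed G 3 (D ∪ T) := closed_add hD hTD (by rw [hTc]; exact hden D subset_rfl hu) (by omega)
    have huniq : ∀ d ∈ D ∪ T, G.Adj y' d → d = y := fun d hd h =>
      hDT.uniq le_rfl hy' (Finset.mem_union_right _ hyT) hd hyy.symm h
    simp only [Finset.mem_union, not_or] at hy'
    refine ⟨T ∪ {y'}, y', ?_, by simp, ?_, ?_, ?_, ?_, ?_⟩
    · rw [Finset.card_union_of_disjoint (by simpa using hy'.2), hTc]; simp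
    · rw [Finset.disjoint_union_left]; exact ⟨hTD, by simpa using hy'.1⟩
    · obtain ⟨w, hw⟩ := hw
      exact ⟨SimpleGraph.Walk.cons hyy.symm w, by simp [hw]⟩
    · intro z hz d hd hzd
      rw [Finset.mem_union, Finset.mem_singleton] at hz
      rcases hz with hz | rfl
      · exact hadj z hz d hd hzd
      · have := huniq d (Finset.mem_union_left _ hd) hzd
        subst this
        exact absurd hd (Finset.disjoint_left.1 hTD hyT)
    · intro C hC huC
      have h1 := hden C hC huC
      have := ed_one_le (G := G) (A := C ∪ T) (B := {y'}) (by
        simp only [Finset.disjoint_singleton_right, Finset.mem_union, not_or]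
        exact ⟨fun h => hy'.1 (hC h), hy'.2⟩) (Finset.mem_union_right _ hyT) (by simp) hyy
      rw [ed_singleton, Finset.union_assoc] at this
      omega
    · intro S' hS' hyS' hne
      set S := S'.erase y' with hSdef
      have hS'S : S' = S ∪ {y'} := by
        ext z; simp only [hSdef, Finset.mem_union, Finset.mem_erase, Finset.mem_singleton]
        by_cases hz : z = y'
        · subst hz; simp [hyS']
        · simp [hz]
      have hST : S ⊆ T := by
        intro z hz
        rw [hSdef, Finset.mem_erase] at hz
        have := hS' hz.2
        simp only [Finset.mem_union, Finset.mem_singleton] at this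
        tauto
      have hy'S : y' ∉ S := by simp [hSdef]
      have hScard : S'.card = S.card + 1 := by
        rw [hS'S, Finset.card_union_of_disjoint (by simpa using hy'S)]; simp
      have hneS : S ≠ T := fun h => hne (by rw [hS'S, h])
      by_cases hyS : y ∈ S
      · have h1 := hsp S hST hyS hneS
        have h2 := ed_insert_le (G := G) (A := D ∪ S) (y := y') (u := y) (fun d hd h =>
          huniq d (Finset.union_subset_union_right hST hd) h)
        rw [hS'S, ← Finset.union_assoc, ← hS'S, hScard]
        omega
      · have h1 := hD S (Finset.disjoint_of_subset_left hST hTD)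
          (by have := Finset.card_le_card hST; omega)
        have h2 := ed_union_le (G := G) (A := D ∪ S) (B := {y'}) (by
          intro d hd z hz h
          rw [Finset.mem_singleton] at hz
          subst hz
          have h3 := huniq d (Finset.union_subset_union_right hST hd) h.symm
          subst h3
          rw [Finset.mem_union] at hd
          rcases hd with hd | hd
          · exact Finset.disjoint_left.1 hTD hyT hd
          · exact hyS hd)
        rw [ed_singleton] at h2
        rw [hS'S, ← Finset.union_assoc, ← hS'S, hScard]
        omega

/-- uncrossing with the tail -/
lemma uncross {C T S : Finset V}
    (h1 : ed G C + T.card ≤ ed G (C ∪ T)) (h2 : ed G C + S.card ≤ ed G (C ∪ S))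
    (h3 : ed G (C ∪ (S ∩ T)) < ed G C + (S ∩ T).card) :
    ed G C + (S ∪ T).card + 1 ≤ ed G (C ∪ (S ∪ T)) := by
  have := ed_rel (G := G) (A := S) (B := T) (C := C)
  have := Finset.card_union_add_card_inter S T
  omega

lemma resp_one {M P Q a b B : ℕ} (hp : Par M P Q a b) (g : Good M P Q B G) {C : Finset V} {h : ℕ}
    (hh : 1 ≤ h) (hhM : 2 * h ≤ M) (hM : 4 ≤ M) (hC : Closed G (2 * h) C)
    (hB : C.card + M * (P * C.card) + M ≤ B) {u : V} (hu : u ∈ C) :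
    ∃ y, y ∉ C ∧ Clean G h C y ∧ HW G h y u ∧ ∀ d ∈ C, HW G h y d → d = u := by
  obtain ⟨D, hCD, hD, hDc⟩ := g.closure' hp C hB
  obtain ⟨t, rfl⟩ : ∃ t, h = t + 1 := ⟨h - 1, by omega⟩
  obtain ⟨T, y, hTc, hyT, hTD, hw, hadj, hden, hsp⟩ := tail_path g (hCD hu) hD t (by omega) (by omega)
  have hyD : y ∉ D := Finset.disjoint_left.1 hTD hyT
  have hspC : ∀ C' ⊆ D, ∀ S ⊆ T, y ∈ S → S ≠ T → ed G (C' ∪ S) < ed G C' + S.card := by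
    intro C' hC' S hS hyS hne
    have h1 := hsp S hS hyS hne
    have h2 := ed_rel_mono (G := G) hC' (Finset.disjoint_of_subset_left hS hTD)
    omega
  have hclean : ∀ C' ⊆ D, u ∈ C' → Closed G (2 * (t + 1)) C' → Clean G (t + 1) C' y := by
    intro C' hC' huC' hcl S hyS hSC hSc
    by_contra hcon
    push Not at hcon
    have h3 := hspC C' hC' (S ∩ T) Finset.inter_subset_right (Finset.mem_inter.2 ⟨hyS, hyT⟩) (by
      intro heq
      have : T ⊆ S := by rw [← heq]; exact Finset.inter_subset_left
      have := Finset.card_le_card this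
      omega)
    have h4 := uncross (by rw [hTc]; exact hden C' hC' huC') hcon h3
    have hpos : 0 < (S ∩ T).card := Finset.card_pos.2 ⟨y, Finset.mem_inter.2 ⟨hyS, hyT⟩⟩
    have hcu := Finset.card_union_add_card_inter S T
    have h5 := hcl (S ∪ T) (Finset.disjoint_union_left.2 ⟨hSC, Finset.disjoint_of_subset_right hC' hTD⟩) (by omega)
    omega
  refine ⟨y, fun h => hyD (hCD h), hclean C hCD hu hC, hw, ?_⟩
  intro d hd hwd
  obtain ⟨S, hyS, hSD, hSc, hSe, s, hs, hsd⟩ :=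
    (hclean D subset_rfl (hCD hu) (hD.mono (by omega))).one_target hyD hwd (hCD hd)
  by_cases hST : S = T
  · subst hST
    exact hadj s hs d (hCD hd) hsd
  · exfalso
    have h3 := hspC D subset_rfl (S ∩ T) Finset.inter_subset_right (Finset.mem_inter.2 ⟨hyS, hyT⟩) (by
      intro heq
      have : T ⊆ S := by rw [← heq]; exact Finset.inter_subset_left
      exact hST (Finset.eq_of_subset_of_card_le this (by omega)).symm)
    have h6 := ed_one_le (G := G) hSD hs (hCD hd) hsd
    rw [Finset.union_comm] at h6
    have h4 := uncross (by rw [hTc]; exact hden D subset_rfl (hCD hu)) (by omega) h3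
    have hpos : 0 < (S ∩ T).card := Finset.card_pos.2 ⟨y, Finset.mem_inter.2 ⟨hyS, hyT⟩⟩
    have hcu := Finset.card_union_add_card_inter S T
    have h5 := hD (S ∪ T) (Finset.disjoint_union_left.2 ⟨hSD, hTD⟩) (by omega)
    omega

lemma ed_bot (S : Finset V) : ed (⊥ : SimpleGraph V) S = 0 := by
  simp [ed]

lemma resp_empty {M P Q a b B : ℕ} (hp : Par M P Q a b) (g : Good M P Q B G) {C : Finset V} {h : ℕ}
    (hh : 1 ≤ h) (hhM : 2 * h ≤ M) (hC : Closed G (2 * h) C) (hB : C.card + 1 ≤ B) :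
    ∃ y, y ∉ C ∧ Clean G h C y ∧ ∀ d ∈ C, ¬ HW G h y d := by
  classical
  have hP : 0 < P := by have := hp.hQ; have := hp.hb; omega
  obtain ⟨φ, hφ, hcl⟩ := g.w3' hp (ι := Fin (C.card + 1)) (by simpa using hB) ⊥ (by
    intro S hS
    rw [ed_bot, mul_zero]
    exact Nat.mul_pos hP (Finset.card_pos.2 hS))
  set D := Finset.univ.map φ with hDdef
  have hD0 : ed G D = 0 := by rw [hDdef, ed_map, ← hφ, ed_bot]
  have hmem : ∀ i, φ i ∈ D := fun i => by simp [hDdef]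
  obtain ⟨i, hi⟩ : ∃ i, ∀ n ≤ h, ∀ d ∈ C, ¬ HW G n (φ i) d := by
    by_contra hcon
    push Not at hcon
    choose n hn d hd hw using hcon
    obtain ⟨i, -, j, -, hij, hdij⟩ := Finset.exists_ne_map_eq_of_card_lt_of_maps_to
      (s := Finset.univ) (t := C) (f := d) (by simp) (fun i _ => hd i)
    obtain ⟨w, hwl⟩ := (hw i).trans (hdij ▸ (hw j).symm)
    have hne : φ j ≠ φ i := fun h => hij (φ.injective h).symm
    obtain ⟨A, h1, h2, h3, s, hs, d', hd', h4, h5⟩ := link (D := D.erase (φ i)) w (Finset.mem_singleton_self _)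
      (Finset.mem_erase.2 ⟨hne, hmem j⟩) (by simp)
    simp only [Finset.card_singleton, ed_singleton] at h3 h5
    have hiA : φ i ∈ A := h1 (by simp)
    have h6 := ed_one_le (G := G) h2 hs hd' h4
    have hAc := Finset.card_erase_add_one hiA
    have hset : A ∪ D.erase (φ i) = D ∪ A.erase (φ i) := by
      ext z
      simp only [Finset.mem_union, Finset.mem_erase]
      by_cases hz : z = φ i
      · subst hz; simp [hiA, hmem i]
      · simp [hz]; tauto
    have hni := hn i
    have hnj := hn j
    have h7 := hcl (A.erase (φ i)) (by
      rw [Finset.disjoint_left] at h2 ⊢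
      intro z hz hzD
      rw [Finset.mem_erase] at hz
      exact h2 hz.2 (Finset.mem_erase.2 ⟨hz.1, hzD⟩)) (by rcases h5 with ⟨h5, -⟩ | h5 <;> omega)
    rw [hset] at h6
    omega
  have hyC : φ i ∉ C := fun hc => hi 0 (by omega) _ hc ⟨.nil, rfl⟩
  refine ⟨φ i, hyC, ?_, fun d hd => hi h le_rfl d hd⟩
  intro S hyS hSC hSc
  by_contra hcon
  push Not at hcon
  rcases not_clean (s := h - 1) (hC.mono (by omega)) hyS hSC (by omega) hcon with ⟨K, hyK, hKS, hK⟩ | ⟨d, hd, n, hn, hw⟩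
  · have h1 := ed_super (G := G) D K
    have h2 : ed G (D ∩ K) ≤ ed G D := ed_mono Finset.inter_subset_left
    have h3 := Finset.card_sdiff_add_card_inter K D
    have h4 : 0 < (K ∩ D).card := Finset.card_pos.2 ⟨φ i, Finset.mem_inter.2 ⟨hyK, hmem i⟩⟩
    have h5 := Finset.card_le_card hKS
    have h6 := hcl (K \ D) Finset.sdiff_disjoint (by omega)
    rw [Finset.union_sdiff_self_eq_union] at h6
    omega
  · exact hi n (by omega) d hd hw

/-- isolated disjoint copy of a sparse graph away from `C` -/
lemma resp_copy {M P Q a b B : ℕ} (hp : Par M P Q a b) (g : Good M P Q B G) {C : Finset V}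
    {κ : Type} [Fintype κ] [DecidableEq κ] (H : SimpleGraph κ)
    (hH : ∀ S : Finset κ, S.Nonempty → Q * ed H S < P * S.card)
    (hB : (C.card + 1) * Fintype.card κ ≤ B) :
    ∃ φ : κ ↪ V, H = G.comap φ ∧ (∀ k, φ k ∉ C) ∧ ∀ k, ∀ d ∈ C, ¬ G.Adj d (φ k) := by
  classical
  let HH : SimpleGraph (Fin (C.card + 1) × κ) :=
    { Adj := fun z w => z.1 = w.1 ∧ H.Adj z.2 w.2
      symm := ⟨fun z w h => ⟨h.1.symm, h.2.symm⟩⟩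
      loopless := ⟨fun z h => H.irrefl h.2⟩ }
  have hst : ∀ n, ∀ S : Finset (Fin (C.card + 1) × κ), S.card ≤ n → S.Nonempty →
      Q * ed HH S < P * S.card := by
    intro n
    induction n with
    | zero =>
      intro S h1 h2
      have := Finset.card_pos.2 h2
      omega
    | succ n ih =>
      intro S h1 ⟨⟨i, k⟩, hik⟩
      set S1 := S.filter (fun z => z.1 = i) with hS1
      set S2 := S.filter (fun z => ¬ z.1 = i) with hS2
      have hun : S1 ∪ S2 = S := Finset.filter_union_filter_not_eq _ _
      have hcardd : S1.card + S2.card = S.card := Finset.card_filter_add_card_filter_not _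
      have hle : ed HH S ≤ ed HH S1 + ed HH S2 := by
        rw [← hun]
        apply ed_union_le
        intro z hz w hw hzw
        rw [hS1, Finset.mem_filter] at hz
        rw [hS2, Finset.mem_filter] at hw
        exact hw.2 (hzw.1 ▸ hz.2)
      have h1ne : S1.Nonempty := ⟨(i, k), by simp [hS1, hik]⟩
      have hb1 : Q * ed HH S1 < P * S1.card := by
        let e : κ ↪ Fin (C.card + 1) × κ := ⟨fun k => (i, k), fun k k' h => by simpa using h⟩
        have hS1e : S1 = (S1.image Prod.snd).map e := by
          ext ⟨j, l⟩
          simp only [hS1, Finset.mem_map, Finset.mem_image, Finset.mem_filter]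
          constructor
          · rintro ⟨h, rfl⟩
            exact ⟨l, ⟨(j, l), ⟨h, rfl⟩, rfl⟩, rfl⟩
          · rintro ⟨l', ⟨⟨j', l''⟩, ⟨h, h'⟩, rfl⟩, h2⟩
            have h2 : (i, l'') = (j, l) := h2
            rw [Prod.mk.injEq] at h2
            obtain ⟨rfl, rfl⟩ := h2
            simp only at h'
            subst h'
            exact ⟨h, rfl⟩
        have hcm : HH.comap e = H := by
          ext z w
          change (i = i ∧ H.Adj z w) ↔ H.Adj z w
          simp
        rw [hS1e, ed_map, hcm, Finset.card_map]
        exact hH _ (h1ne.image _)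
      rcases S2.eq_empty_or_nonempty with h2e | h2ne
      · rw [h2e, Finset.union_empty] at hun
        rw [hun] at hb1
        exact hb1
      · have hpos := Finset.card_pos.2 h1ne
        have hb2 := ih S2 (by omega) h2ne
        calc Q * ed HH S ≤ Q * (ed HH S1 + ed HH S2) := Nat.mul_le_mul_left _ hle
          _ = Q * ed HH S1 + Q * ed HH S2 := by ring
          _ < P * S1.card + P * S2.card := by omega
          _ = P * S.card := by rw [← hcardd]; ring
  obtain ⟨φ, hφ, hcl⟩ := g.w3' hp (by simpa using hB) HH (fun S hS => hst _ S le_rfl hS)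
  set D := Finset.univ.map φ with hDdef
  have hmem : ∀ i, φ i ∈ D := fun i => by simp [hDdef]
  have hadj : ∀ z w, G.Adj (φ z) (φ w) → z.1 = w.1 := by
    intro z w h
    have : HH.Adj z w := by rw [hφ]; exact h
    exact this.1
  obtain ⟨i, hi⟩ : ∃ i, ∀ k, ∀ d ∈ C, φ (i, k) ≠ d ∧ ¬ G.Adj d (φ (i, k)) := by
    by_contra hcon
    push Not at hcon
    choose k d hd hw using hcon
    obtain ⟨i, -, j, -, hij, hdij⟩ := Finset.exists_ne_map_eq_of_card_lt_of_maps_to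
      (s := Finset.univ) (t := C) (f := d) (by simp) (fun i _ => hd i)
    have hwi := hw i
    have hwj := hw j
    rw [← hdij] at hwj
    by_cases hdD : d i ∈ D
    · rw [hDdef, Finset.mem_map] at hdD
      obtain ⟨m, -, hm⟩ := hdD
      have ci : m.1 = i := by
        by_cases hc : φ (i, k i) = d i
        · rw [← hm] at hc; exact (congrArg Prod.fst (φ.injective hc)).symm
        · have h1 := hwi hc; rw [← hm] at h1; exact hadj _ _ h1
      have cj : m.1 = j := by
        by_cases hc : φ (j, k j) = d i
        · rw [← hm] at hc; exact (congrArg Prod.fst (φ.injective hc)).symm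
        · have h1 := hwj hc; rw [← hm] at h1; exact hadj _ _ h1
      exact hij (ci.symm.trans cj)
    · have ai := hwi (fun h => hdD (h ▸ hmem _))
      have aj := hwj (fun h => hdD (h ▸ hmem _))
      have := (hcl.uniq (by have := hp.hM; omega) hdD (hmem _) (hmem _) ai aj)
      exact hij (congrArg Prod.fst (φ.injective this)).symm
  refine ⟨⟨fun k => φ (i, k), fun k k' h => by simpa using φ.injective h⟩, ?_, ?_, ?_⟩
  · ext z w
    have : HH.Adj (i, z) (i, w) ↔ G.Adj (φ (i, z)) (φ (i, w)) := by rw [hφ]; rfl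
    change H.Adj z w ↔ G.Adj (φ (i, z)) (φ (i, w))
    rw [← this]
    change _ ↔ (i = i ∧ H.Adj z w)
    simp
  · intro k hk
    exact (hi k _ hk).1 rfl
  · intro k d hd
    exact (hi k d hd).2

end Resp

end ZOK

namespace ZOK

set_option linter.unusedSectionVars false

section Step
variable {V W : Type} [DecidableEq V] [DecidableEq W] {G : SimpleGraph V} {G' : SimpleGraph W}

/-- range of an embedding as a finset -/
def rng {ι : Type} [Fintype ι] {V : Type} (u : ι ↪ V) : Finset V := Finset.univ.map u

lemma mem_rng {ι : Type} [Fintype ι] {u : ι ↪ V} {x : V} : x ∈ rng u ↔ ∃ i, u i = x := by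
  simp [rng]

lemma card_rng {ι : Type} [Fintype ι] (u : ι ↪ V) : (rng u).card = Fintype.card ι := by
  simp [rng]

/-- the two embeddings induce the same graph -/
def Same (G : SimpleGraph V) (G' : SimpleGraph W) {ι : Type} (u : ι ↪ V) (v : ι ↪ W) : Prop :=
  ∀ i j, G.Adj (u i) (u j) ↔ G'.Adj (v i) (v j)

/-- matching of the critical vertices -/
def Half (h : ℕ) (G : SimpleGraph V) (G' : SimpleGraph W) (C : Finset V) (C' : Finset W) {j : ℕ}
    (xs : Fin j → V) (ys : Fin j → W) : Prop :=
  ∀ x, x ∉ C → Clean G h C x → (∃ i i', xs i ≠ xs i' ∧ HW G h x (xs i) ∧ HW G h x (xs i')) →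
    ∃ y, y ∉ C' ∧ Clean G' h C' y ∧ ∀ i, HW G h x (xs i) ↔ HW G' h y (ys i)

def Inv (c h : ℕ) (G : SimpleGraph V) (G' : SimpleGraph W) {j : ℕ} (xs : Fin j → V) (ys : Fin j → W) : Prop :=
  ∃ (ι : Type) (_ : Fintype ι) (u : ι ↪ V) (v : ι ↪ W) (idx : Fin j → ι),
    Fintype.card ι ≤ c ∧ (∀ i, xs i = u (idx i)) ∧ (∀ i, ys i = v (idx i)) ∧ Same G G' u v ∧
    Closed G (2 * h) (rng u) ∧ Closed G' (2 * h) (rng v) ∧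
    Half h G G' (rng u) (rng v) xs ys ∧ Half h G' G (rng v) (rng u) ys xs

lemma Inv.symm {c h j : ℕ} {xs : Fin j → V} {ys : Fin j → W} (hJ : Inv c h G G' xs ys) :
    Inv c h G' G ys xs := by
  obtain ⟨ι, _, u, v, idx, h1, h2, h3, h4, h5, h6, h7, h8⟩ := hJ
  exact ⟨ι, _, v, u, idx, h1, h3, h2, fun i j => (h4 i j).symm, h6, h5, h8, h7⟩

lemma Inv.atomic {c h j : ℕ} {xs : Fin j → V} {ys : Fin j → W} (hJ : Inv c h G G' xs ys) (i i' : Fin j) :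
    (xs i = xs i' ↔ ys i = ys i') ∧ (G.Adj (xs i) (xs i') ↔ G'.Adj (ys i) (ys i')) := by
  obtain ⟨ι, _, u, v, idx, h1, h2, h3, h4, -⟩ := hJ
  rw [h2, h2, h3, h3, u.injective.eq_iff, v.injective.eq_iff]
  exact ⟨Iff.rfl, h4 _ _⟩

lemma half_vac {h : ℕ} {C : Finset V} {C' : Finset W} {j : ℕ} {xs : Fin j → V} {ys : Fin j → W}
    (hC : Closed G (2 * h + 1) C) (hxs : ∀ i, xs i ∈ C) : Half h G G' C C' xs ys := by
  rintro x hx hcl ⟨i, i', hne, h1, h2⟩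
  obtain ⟨B, -, hB, hBc, hBe⟩ := hcl.two_target hx (hxs i) (hxs i') hne h1 h2
  have h3 := hBe C subset_rfl (hxs i) (hxs i')
  have h4 := hC B hB (by omega)
  omega

lemma inv_of_closed {c h j : ℕ} {xs : Fin j → V} {ys : Fin j → W} (ι : Type) [Fintype ι] (u : ι ↪ V) (v : ι ↪ W)
    (idx : Fin j → ι) (h1 : Fintype.card ι ≤ c) (h2 : ∀ i, xs i = u (idx i)) (h3 : ∀ i, ys i = v (idx i))
    (h4 : Same G G' u v) (h5 : Closed G (2 * h + 1) (rng u)) (h6 : Closed G' (2 * h + 1) (rng v)) :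
    Inv c h G G' xs ys :=
  ⟨ι, _, u, v, idx, h1, h2, h3, h4, h5.mono (by omega), h6.mono (by omega),
    half_vac h5 (fun i => mem_rng.2 ⟨_, (h2 i).symm⟩), half_vac h6 (fun i => mem_rng.2 ⟨_, (h3 i).symm⟩)⟩

lemma rng_option {ι : Type} [Fintype ι] (u : ι ↪ V) (x : V) (hx : x ∉ Set.range u) :
    rng (Function.Embedding.optionElim u x hx) = rng u ∪ {x} := by
  ext z
  simp only [mem_rng, Finset.mem_union, Finset.mem_singleton]
  constructor
  · rintro ⟨_ | i, rfl⟩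
    · right; rfl
    · left; exact ⟨i, rfl⟩
  · rintro (⟨i, rfl⟩ | rfl)
    · exact ⟨some i, rfl⟩
    · exact ⟨none, rfl⟩

lemma same_option {ι : Type} [Fintype ι] {u : ι ↪ V} {v : ι ↪ W} (hs : Same G G' u v) {x : V} {y : W}
    (hx : x ∉ Set.range u) (hy : y ∉ Set.range v) (hxy : ∀ i, G.Adj (u i) x ↔ G'.Adj (v i) y) :
    Same G G' (Function.Embedding.optionElim u x hx) (Function.Embedding.optionElim v y hy) := by
  rintro (_ | i) (_ | j)
  · change G.Adj x x ↔ G'.Adj y y; simp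
  · change G.Adj x (u j) ↔ G'.Adj y (v j); rw [G.adj_comm, G'.adj_comm]; exact hxy j
  · exact hxy i
  · exact hs i j

lemma not_mem_range {ι : Type} [Fintype ι] {u : ι ↪ V} {x : V} (h : x ∉ rng u) : x ∉ Set.range u := by
  rw [mem_rng] at h
  exact h

/-- copying a walk -/
lemma pend {M P Q B : ℕ} (g' : Good M P Q B G') {x : V} :
    ∀ (t r : ℕ), t + 2 ≤ r → ∀ (ι : Type) [Fintype ι] (u : ι ↪ V) (v : ι ↪ W), Same G G' u v →
      Closed G r (rng u) → Closed G' r (rng v) → Fintype.card ι + t ≤ B → ∀ i0, HW G t (u i0) x →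
      ∃ (κ : Type) (_ : Fintype κ) (u' : κ ↪ V) (v' : κ ↪ W) (e : ι → κ) (k0 : κ), u' k0 = x ∧
        (∀ i, u' (e i) = u i) ∧ (∀ i, v' (e i) = v i) ∧ Same G G' u' v' ∧ Fintype.card κ ≤ Fintype.card ι + t ∧
        Closed G (r - t) (rng u') ∧ Closed G' (r - t) (rng v') := by
  intro t
  induction t with
  | zero =>
    intro r hr ι _ u v hs hcu hcv hB i0 ⟨w, hw⟩
    have := SimpleGraph.Walk.eq_of_length_eq_zero hw
    exact ⟨ι, _, u, v, id, i0, this, fun _ => rfl, fun _ => rfl, hs, le_rfl, hcu, hcv⟩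
  | succ t ih =>
    intro r hr ι _ u v hs hcu hcv hB i0 ⟨w, hw⟩
    cases w with
    | nil => simp at hw
    | @cons _ z _ hadj p =>
    rw [SimpleGraph.Walk.length_cons] at hw
    have hp : HW G t z x := ⟨p, by omega⟩
    by_cases hz : z ∈ rng u
    · obtain ⟨i1, rfl⟩ := mem_rng.1 hz
      obtain ⟨κ, _, u', v', e, k0, h1, h2, h3, h4, h5, h6, h7⟩ := ih r (by omega) ι u v hs hcu hcv (by omega) i1 hp
      exact ⟨κ, _, u', v', e, k0, h1, h2, h3, h4, by omega, h6.mono (by omega), h7.mono (by omega)⟩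
    · obtain ⟨z', hz', hadj'⟩ := g'.w2 (v i0) (rng v) (by rw [card_rng]; omega)
      have hmu : u i0 ∈ rng u := mem_rng.2 ⟨_, rfl⟩
      have hmv : v i0 ∈ rng v := mem_rng.2 ⟨_, rfl⟩
      have hzr := not_mem_range hz
      have hzr' := not_mem_range hz'
      have hnew : ∀ i, G.Adj (u i) z ↔ G'.Adj (v i) z' := by
        intro i
        constructor
        · intro h
          have h1 := hcu.uniq (by omega) hz hmu (mem_rng.2 ⟨i, rfl⟩) hadj.symm h.symm
          rw [u.injective h1]; exact hadj'
        · intro h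
          have h1 := hcv.uniq (by omega) hz' hmv (mem_rng.2 ⟨i, rfl⟩) hadj'.symm h.symm
          rw [v.injective h1]; exact hadj
      have hc1 : Closed G (r - 1) (rng (Function.Embedding.optionElim u z hzr)) := by
        rw [rng_option]
        refine closed_add hcu (by simpa using hz) ?_ (by simp; omega)
        have := ed_one_le (G := G) (A := rng u) (B := {z}) (by simpa using hz) hmu (by simp) hadj
        rw [Finset.card_singleton]; omega
      have hc2 : Closed G' (r - 1) (rng (Function.Embedding.optionElim v z' hzr')) := by
        rw [rng_option]
        refine closed_add hcv (by simpa using hz') ?_ (by simp; omega)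
        have := ed_one_le (G := G') (A := rng v) (B := {z'}) (by simpa using hz') hmv (by simp) hadj'
        rw [Finset.card_singleton]; omega
      obtain ⟨κ, _, u', v', e, k0, h1, h2, h3, h4, h5, h6, h7⟩ := ih (r - 1) (by omega) (Option ι) _ _
        (same_option hs hzr hzr' hnew) hc1 hc2 (by rw [Fintype.card_option]; omega) none hp
      rw [Fintype.card_option] at h5
      exact ⟨κ, _, u', v', fun i => e (some i), k0, h1, fun i => h2 _, fun i => h3 _, h4, by omega,
        h6.mono (by omega), h7.mono (by omega)⟩

lemma two_old {h : ℕ} (_hh : 1 ≤ h) {C D : Finset V} (hC : Closed G (4 * h) C) (hCD : C ⊆ D) {z p q : V}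
    (hz : z ∉ D) (hcl : Clean G h D z) (hp : p ∈ C) (hq : q ∈ C) (h1 : HW G h z p) (h2 : HW G h z q) : p = q := by
  by_contra hne
  obtain ⟨B, -, hB, hBc, hBe⟩ := hcl.two_target hz (hCD hp) (hCD hq) hne h1 h2
  have h3 := hBe C hCD hp hq
  have h4 := hC B (Finset.disjoint_of_subset_right hCD hB) (by omega)
  omega

lemma closed_insert {h : ℕ} {C : Finset V} {x : V} (hx : x ∉ C) (hcl : Clean G h C x) :
    Closed G h (C ∪ {x}) := by
  intro U hU hUc
  rw [Finset.disjoint_union_right] at hU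
  have h1 : Disjoint ({x} : Finset V) U := hU.2.symm
  have hc : ({x} ∪ U).card = U.card + 1 := by
    rw [Finset.card_union_of_disjoint h1]; simp [add_comm]
  have h2 := hcl ({x} ∪ U) (by simp) (by rw [Finset.disjoint_union_left]; exact ⟨by simpa using hx, hU.1⟩) (by omega)
  rw [← Finset.union_assoc, hc] at h2
  have h3 : ed G C ≤ ed G (C ∪ {x}) := ed_mono Finset.subset_union_left
  omega

lemma mid {h : ℕ} (hh : 1 ≤ h) {C : Finset V} (hC : Closed G (4 * h) C) {x p : V} (hx : x ∉ C)
    (hcl : Clean G (2 * h) C x) (hp : p ∈ C) (hw : HW G (2 * h) x p) :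
    ∃ z, z ∉ C ∪ {x} ∧ Clean G h (C ∪ {x}) z ∧ HW G h z x ∧ HW G h z p := by
  rw [two_mul] at hw
  obtain ⟨z, hxz, hzp⟩ := hw.split
  have hzC : z ∉ C := fun h' => by have := hcl.le_length hx hxz h'; omega
  have hzx : z ≠ x := by rintro rfl; have := hcl.le_length hx hzp hp; omega
  have hzD : z ∉ C ∪ {x} := by simp [hzC, hzx]
  refine ⟨z, hzD, ?_, hxz.symm, hzp⟩
  intro S hzS hSD hSc
  by_contra hcon
  push Not at hcon
  rcases not_clean (s := h - 1) ((closed_insert hx hcl).mono (by omega)) hzS hSD (by omega) hcon with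
    ⟨K, hzK, hKS, hK⟩ | ⟨d, hd, n, hn, hw2⟩
  · have hKc := Finset.card_le_card hKS
    obtain ⟨w, hwl⟩ := hxz.symm
    obtain ⟨A, h1, h2, h3, s, hs, d', hd', h4, h5⟩ := link (D := C ∪ {x}) w hzK (by simp)
      (Finset.disjoint_of_subset_left hKS hSD)
    have hAc : A.card + 1 ≤ K.card + w.length := by rcases h5 with ⟨h5, -⟩ | h5 <;> omega
    rw [Finset.disjoint_union_right] at h2
    rw [Finset.mem_union, Finset.mem_singleton] at hd'
    rcases hd' with hd' | rfl
    · have h6 := ed_one_le (G := G) h2.1 hs hd' h4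
      rw [Finset.union_comm] at h6
      have h7 := hC A h2.1 (by omega)
      omega
    · have h6 := ed_one_le (G := G) h2.2 hs (Finset.mem_singleton_self _) h4
      rw [ed_singleton] at h6
      have hcard : (A ∪ {d'}).card = A.card + 1 := by rw [Finset.card_union_of_disjoint h2.2]; simp
      have hdis : Disjoint (A ∪ {d'}) C := by
        rw [Finset.disjoint_union_left]; exact ⟨h2.1, by simpa using hx⟩
      have h7 := hcl (A ∪ {d'}) (by simp) hdis (by omega)
      have h8 := ed_disj_le (G := G) hdis
      rw [Finset.union_comm _ C] at h8
      omega
  · rw [Finset.mem_union, Finset.mem_singleton] at hd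
    rcases hd with hd | rfl
    · have := hcl.le_length hx (hxz.trans hw2) hd; omega
    · have := hcl.le_length hx (hw2.symm.trans hzp) hp; omega

lemma half_step {h j : ℕ} (hh : 1 ≤ h) {C : Finset V} {C' : Finset W} {xs : Fin j → V} {ys : Fin j → W}
    (hxs : ∀ i, xs i ∈ C) (hys : ∀ i, ys i ∈ C') (hat : ∀ i i', xs i = xs i' ↔ ys i = ys i')
    (hC : Closed G (4 * h) C) (hC' : Closed G' (4 * h) C') {x : V} {y : W} (hy : y ∉ C')
    (hcly : Clean G' (2 * h) C' y)
    (hI : ∀ i, HW G (2 * h) x (xs i) ↔ HW G' (2 * h) y (ys i)) :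
    Half h G G' (C ∪ {x}) (C' ∪ {y}) (Fin.snoc xs x : Fin (j + 1) → V) (Fin.snoc ys y : Fin (j + 1) → W) := by
  rintro z hz hclz ⟨l, l', hne, h1, h2⟩
  obtain ⟨i, hzx, hzi⟩ : ∃ i, HW G h z x ∧ HW G h z (xs i) := by
    induction l using Fin.lastCases with
    | last =>
      induction l' using Fin.lastCases with
      | last => simp at hne
      | cast i' =>
        simp only [Fin.snoc_last, Fin.snoc_castSucc] at h1 h2
        exact ⟨i', h1, h2⟩
    | cast i =>
      induction l' using Fin.lastCases with
      | last =>
        simp only [Fin.snoc_last, Fin.snoc_castSucc] at h1 h2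
        exact ⟨i, h2, h1⟩
      | cast i' =>
        simp only [Fin.snoc_castSucc] at h1 h2 hne
        exact absurd (two_old hh hC Finset.subset_union_left hz hclz (hxs i) (hxs i') h1 h2) hne
  have hxi : HW G (2 * h) x (xs i) := by rw [two_mul]; exact hzx.symm.trans hzi
  obtain ⟨z', hz', hclz', hz'y, hz'i⟩ := mid hh hC' hy hcly (hys i) ((hI i).1 hxi)
  refine ⟨z', hz', hclz', ?_⟩
  intro l
  induction l using Fin.lastCases with
  | last => simp only [Fin.snoc_last]; exact ⟨fun _ => hz'y, fun _ => hzx⟩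
  | cast l =>
    simp only [Fin.snoc_castSucc]
    constructor
    · intro h3
      have h4 := two_old hh hC Finset.subset_union_left hz hclz (hxs l) (hxs i) h3 hzi
      rw [(hat _ _).1 h4]; exact hz'i
    · intro h3
      have h4 := two_old hh hC' Finset.subset_union_left hz' hclz' (hys l) (hys i) h3 hz'i
      rw [(hat _ _).2 h4]; exact hzi

/-- the response to a clean vertex -/
lemma resp {M P Q a b B : ℕ} (hp : Par M P Q a b) (g' : Good M P Q B G') (hM : 4 ≤ M) {h j : ℕ} (hh : 1 ≤ h) (hhM : 2 * h ≤ M)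
    {C : Finset V} {C' : Finset W} {xs : Fin j → V} {ys : Fin j → W}
    (hys : ∀ i, ys i ∈ C') (hat : ∀ i i', xs i = xs i' ↔ ys i = ys i')
    (hC' : Closed G' (2 * h) C') (hB : C'.card + M * (P * C'.card) + M ≤ B)
    (hHalf : Half h G G' C C' xs ys) {x : V} (hx : x ∉ C) (hcl : Clean G h C x) :
    ∃ y, y ∉ C' ∧ Clean G' h C' y ∧ ∀ i, HW G h x (xs i) ↔ HW G' h y (ys i) := by
  by_cases h2 : ∃ i i', xs i ≠ xs i' ∧ HW G h x (xs i) ∧ HW G h x (xs i')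
  · exact hHalf x hx hcl h2
  push Not at h2
  by_cases h1 : ∃ i, HW G h x (xs i)
  · obtain ⟨i, hi⟩ := h1
    obtain ⟨y, hy, hcly, hyi, hyd⟩ := resp_one hp g' hh hhM hM hC' hB (hys i)
    refine ⟨y, hy, hcly, fun l => ⟨fun hl => ?_, fun hl => ?_⟩⟩
    · by_cases he : xs i = xs l
      · rw [← (hat _ _).1 he]; exact hyi
      · exact absurd hl (h2 i l he hi)
    · have h3 := hyd _ (hys l) hl
      rw [(hat _ _).2 h3]; exact hi
  · push Not at h1
    obtain ⟨y, hy, hcly, hyd⟩ := resp_empty hp g' hh hhM hC' (by omega)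
    exact ⟨y, hy, hcly, fun l => ⟨fun hl => absurd hl (h1 l), fun hl => absurd hl (hyd _ (hys l))⟩⟩

lemma snoc_idx {ι κ : Type} {j : ℕ} {U : Type} {xs : Fin j → U} {u : ι → U} {idx : Fin j → ι} (h2 : ∀ i, xs i = u (idx i))
    {u' : κ → U} {e : ι → κ} (he : ∀ i, u' (e i) = u i) {x : U} {k0 : κ} (hx : x = u' k0) :
    ∀ i, (Fin.snoc xs x : Fin (j + 1) → U) i = u' ((Fin.snoc (fun l => e (idx l)) k0 : Fin (j + 1) → κ) i) := by
  intro i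
  induction i using Fin.lastCases with
  | last => simp [hx]
  | cast i => simp [he, h2]

lemma inv_step {M P Q a b B : ℕ} (hp : Par M P Q a b) (g : Good M P Q B G) (g' : Good M P Q B G') (hM : 4 ≤ M)
    {c h j : ℕ} (hh : 1 ≤ h) (hhM : 4 * h ≤ M) (hB : (c + 1) * (M * P + M + 1) ≤ B)
    {xs : Fin j → V} {ys : Fin j → W} (hJ : Inv c (2 * h) G G' xs ys) (x : V) :
    ∃ y, Inv (c + M) h G G' (Fin.snoc xs x : Fin (j + 1) → V) (Fin.snoc ys y : Fin (j + 1) → W) := by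
  classical
  have hat := fun i i' => (hJ.atomic i i').1
  obtain ⟨ι, _, u, v, idx, h1, h2, h3, h4, h5, h6, h7, h8⟩ := hJ
  have hBe : (c + 1) * (M * P + M + 1) = c + M * (P * c) + M + M * c + M * P + 1 := by ring
  have e22 : 2 * (2 * h) = 4 * h := by ring
  rw [e22] at h5 h6
  have hcu := card_rng u
  have hcv := card_rng v
  by_cases hxC : x ∈ rng u
  · obtain ⟨i, rfl⟩ := mem_rng.1 hxC
    exact ⟨v i, inv_of_closed ι u v (Fin.snoc idx i) (by omega) (snoc_idx h2 (fun _ => rfl) rfl)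
      (snoc_idx h3 (fun _ => rfl) rfl) h4 (h5.mono (by omega)) (h6.mono (by omega))⟩
  by_cases hK : ∃ K, x ∈ K ∧ Disjoint K (rng u) ∧ K.card + 1 ≤ 2 * h ∧ K.card ≤ ed G K
  · obtain ⟨K, hxK, hKC, hKc, hKe⟩ := hK
    have hnoadj : ∀ z ∈ K, ∀ d ∈ rng u, ¬ G.Adj z d := by
      intro z hz d hd hzd
      have t1 := ed_one_le (G := G) hKC hz hd hzd
      have t2 := h5 K hKC (by omega)
      rw [Finset.union_comm] at t1
      omega
    have hcardκ : Fintype.card K = K.card := Fintype.card_coe K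
    have hKM : (c + 1) * K.card ≤ B := by
      refine le_trans (Nat.mul_le_mul_left _ ?_) hB
      have : 0 ≤ M * P := Nat.zero_le _
      omega
    obtain ⟨φ, hφ, hφC, hφadj⟩ := resp_copy hp g' (C := rng v) (κ := K) (G.comap (fun z : K => (z : V))) (by
      intro S hS
      have hm := ed_map (G := G) (Function.Embedding.subtype (· ∈ K)) S
      have hsub : S.map (Function.Embedding.subtype (· ∈ K)) ⊆ K := by
        intro z hz
        rw [Finset.mem_map] at hz
        obtain ⟨y, -, rfl⟩ := hz
        exact y.2
      have hle := Finset.card_le_card hsub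
      have := g.strict_small hp (S := S.map (Function.Embedding.subtype (· ∈ K))) (by simpa using hS)
        (by
          have : K.card ≤ (c + 1) * K.card := Nat.le_mul_of_pos_left _ (by omega)
          omega) (Or.inl (by omega))
      rw [hm, Finset.card_map] at this
      exact this) (by
        rw [hcardκ, hcv]
        exact le_trans (Nat.mul_le_mul_right _ (by omega)) hKM)
    let u' : ι ⊕ K ↪ V := ⟨Sum.elim u (fun z => (z : V)), by
      rintro (i | z) (i' | z') hh'
      · simpa using hh'
      · exfalso
        have hh' : u i = z' := hh'
        exact Finset.disjoint_left.1 hKC z'.2 (mem_rng.2 ⟨i, hh'⟩)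
      · exfalso
        have hh' : (z : V) = u i' := hh'
        exact Finset.disjoint_left.1 hKC z.2 (mem_rng.2 ⟨i', hh'.symm⟩)
      · have hh' : (z : V) = z' := hh'
        rw [Subtype.ext hh']⟩
    let v' : ι ⊕ K ↪ W := ⟨Sum.elim v φ, by
      rintro (i | z) (i' | z') hh'
      · simpa using hh'
      · exfalso
        have hh' : v i = φ z' := hh'
        exact hφC z' (mem_rng.2 ⟨i, hh'⟩)
      · exfalso
        have hh' : φ z = v i' := hh'
        exact hφC z (mem_rng.2 ⟨i', hh'.symm⟩)
      · have hh' : φ z = φ z' := hh'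
        rw [φ.injective hh']⟩
    have hru : rng u' = rng u ∪ K := by
      ext z
      simp only [mem_rng, Finset.mem_union]
      constructor
      · rintro ⟨i | k, rfl⟩
        · left; exact ⟨i, rfl⟩
        · right; exact k.2
      · rintro (⟨i, rfl⟩ | hz)
        · exact ⟨.inl i, rfl⟩
        · exact ⟨.inr ⟨z, hz⟩, rfl⟩
    have hrv : rng v' = rng v ∪ rng φ := by
      ext z
      simp only [mem_rng, Finset.mem_union]
      constructor
      · rintro ⟨i | k, rfl⟩
        · left; exact ⟨i, rfl⟩
        · right; exact ⟨k, rfl⟩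
      · rintro (⟨i, rfl⟩ | ⟨k, rfl⟩)
        · exact ⟨.inl i, rfl⟩
        · exact ⟨.inr k, rfl⟩
    have hcphi : (rng φ).card = K.card := by rw [card_rng, hcardκ]
    have hedphi : ed G' (rng φ) = ed G K := by
      have t1 : ed G' (rng φ) = ed (G'.comap φ) Finset.univ := ed_map φ _
      have t2 : ed G ((Finset.univ : Finset K).map (Function.Embedding.subtype (· ∈ K))) =
        ed (G.comap (fun z : K => (z : V))) Finset.univ := ed_map _ _
      have t3 : ((Finset.univ : Finset K).map (Function.Embedding.subtype (· ∈ K))) = K := by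
        ext z; simp
      rw [t1, ← hφ, ← t2, t3]
    have hdis' : Disjoint (rng φ) (rng v) := by
      rw [Finset.disjoint_left]
      intro z hz hz'
      obtain ⟨k, rfl⟩ := mem_rng.1 hz
      exact hφC k hz'
    refine ⟨φ ⟨x, hxK⟩, inv_of_closed (ι ⊕ K) u' v' (Fin.snoc (fun l => Sum.inl (idx l)) (Sum.inr ⟨x, hxK⟩)) ?_
      (snoc_idx (u' := u') (e := Sum.inl) h2 (fun _ => rfl) rfl)
      (snoc_idx (u' := v') (e := Sum.inl) h3 (fun _ => rfl) rfl) ?_ ?_ ?_⟩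
    · rw [Fintype.card_sum, hcardκ]; omega
    · rintro (i | z) (i' | z')
      · exact h4 i i'
      · have t1 : ¬ G.Adj (u i) z' := fun h => hnoadj z' z'.2 (u i) (mem_rng.2 ⟨i, rfl⟩) h.symm
        have t2 : ¬ G'.Adj (v i) (φ z') := hφadj z' (v i) (mem_rng.2 ⟨i, rfl⟩)
        exact ⟨fun h => absurd h t1, fun h => absurd h t2⟩
      · have t1 : ¬ G.Adj z (u i') := fun h => hnoadj z z.2 (u i') (mem_rng.2 ⟨i', rfl⟩) h
        have t2 : ¬ G'.Adj (φ z) (v i') := fun h => hφadj z (v i') (mem_rng.2 ⟨i', rfl⟩) h.symm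
        exact ⟨fun h => absurd h t1, fun h => absurd h t2⟩
      · have : (G.comap (fun z : K => (z : V))).Adj z z' ↔ (G'.comap φ).Adj z z' := by rw [hφ]
        exact this
    · rw [hru]
      refine closed_add h5 hKC ?_ (r' := 2 * h + 1) (by omega)
      have := ed_disj_le (G := G) hKC
      rw [Finset.union_comm] at this
      omega
    · rw [hrv]
      refine closed_add h6 hdis' ?_ (r' := 2 * h + 1) (by omega)
      have := ed_disj_le (G := G') hdis'
      rw [Finset.union_comm] at this
      omega
  by_cases hwalk : ∃ d ∈ rng u, ∃ n, n + 1 ≤ 2 * h ∧ HW G n x d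
  · obtain ⟨d, hd, n, hn, hw⟩ := hwalk
    obtain ⟨i0, rfl⟩ := mem_rng.1 hd
    obtain ⟨κ, _, u', v', e, k0, t1, t2, t3, t4, t5, t6, t7⟩ := pend g' n (4 * h) (by omega) ι u v h4 h5 h6
      (by have : 0 ≤ M * (P * c) := Nat.zero_le _
          have : 0 ≤ M * P := Nat.zero_le _
          omega) i0 hw.symm
    exact ⟨v' k0, inv_of_closed κ u' v' (Fin.snoc (fun l => e (idx l)) k0) (by omega) (snoc_idx h2 t2 t1.symm)
      (snoc_idx h3 t3 rfl) t4 (t6.mono (by omega)) (t7.mono (by omega))⟩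
  push Not at hK hwalk
  have hcl : Clean G (2 * h) (rng u) x := by
    intro S hxS hSC hSc
    by_contra hcon
    push Not at hcon
    rcases not_clean (s := 2 * h - 1) (h5.mono (by omega)) hxS hSC (by omega) hcon with
      ⟨K, hxK, hKS, hKe⟩ | ⟨d, hd, n, hn, hw⟩
    · have := Finset.card_le_card hKS
      have := hK K hxK (Finset.disjoint_of_subset_left hKS hSC) (by omega)
      omega
    · exact hwalk d hd n (by omega) hw
  have hxs : ∀ i, xs i ∈ rng u := fun i => mem_rng.2 ⟨_, (h2 i).symm⟩
  have hys : ∀ i, ys i ∈ rng v := fun i => mem_rng.2 ⟨_, (h3 i).symm⟩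
  have hbud : ∀ c' ≤ c, c' + M * (P * c') + M ≤ B := by
    intro c' hc'
    have := Nat.mul_le_mul_left M (Nat.mul_le_mul_left P hc')
    omega
  obtain ⟨y, hy, hcly, hI⟩ := resp hp g' hM (h := 2 * h) (by omega) (by omega) hys hat (by rw [e22]; exact h6)
    (by rw [hcv]; exact hbud _ h1) h7 hxC hcl
  have hxr := not_mem_range hxC
  have hyr := not_mem_range hy
  refine ⟨y, Option ι, inferInstance, Function.Embedding.optionElim u x hxr, Function.Embedding.optionElim v y hyr,
    Fin.snoc (fun l => some (idx l)) none, by rw [Fintype.card_option]; omega,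
    snoc_idx (u' := Function.Embedding.optionElim u x hxr) (e := some) h2 (fun _ => rfl) rfl,
    snoc_idx (u' := Function.Embedding.optionElim v y hyr) (e := some) h3 (fun _ => rfl) rfl, same_option h4 hxr hyr ?_, ?_, ?_, ?_, ?_⟩
  · intro i
    have t1 : ¬ G.Adj (u i) x := fun h' => by
      have := hcl.le_length hxC ⟨SimpleGraph.Walk.cons h'.symm .nil, rfl⟩ (mem_rng.2 ⟨i, rfl⟩)
      simp at this
      omega
    have t2 : ¬ G'.Adj (v i) y := fun h' => by
      have := hcly.le_length hy ⟨SimpleGraph.Walk.cons h'.symm .nil, rfl⟩ (mem_rng.2 ⟨i, rfl⟩)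
      simp at this
      omega
    exact ⟨fun h => absurd h t1, fun h => absurd h t2⟩
  · rw [rng_option]; exact closed_insert hxC hcl
  · rw [rng_option]; exact closed_insert hy hcly
  · rw [rng_option, rng_option]
    exact half_step hh hxs hys hat h5 h6 hy hcly hI
  · rw [rng_option, rng_option]
    exact half_step hh hys hxs (fun i i' => (hat i i').symm) h6 h5 hxC hcl (fun i => (hI i).symm)

/-- agreement of atomic formulas -/
def Atomic (G : SimpleGraph V) (G' : SimpleGraph W) {j : ℕ} (xs : Fin j → V) (ys : Fin j → W) : Prop :=
  ∀ i l : Fin j, (xs i = xs l ↔ ys i = ys l) ∧ (G.Adj (xs i) (xs l) ↔ G'.Adj (ys i) (ys l))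

/-- back and forth equivalence -/
def Eqv (G : SimpleGraph V) (G' : SimpleGraph W) : ℕ → ∀ {j : ℕ}, (Fin j → V) → (Fin j → W) → Prop
  | 0, _, xs, ys => Atomic G G' xs ys
  | m + 1, _, xs, ys => Atomic G G' xs ys ∧
      (∀ x, ∃ y, Eqv G G' m (Fin.snoc xs x : Fin (_ + 1) → V) (Fin.snoc ys y : Fin (_ + 1) → W)) ∧
      (∀ y, ∃ x, Eqv G G' m (Fin.snoc xs x : Fin (_ + 1) → V) (Fin.snoc ys y : Fin (_ + 1) → W))

lemma Atomic.symm {j : ℕ} {xs : Fin j → V} {ys : Fin j → W} (h : Atomic G G' xs ys) : Atomic G' G ys xs :=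
  fun i i' => ⟨(h i i').1.symm, (h i i').2.symm⟩

lemma inv_last {M P Q a b B : ℕ} (hp : Par M P Q a b) (g' : Good M P Q B G') (hM : 4 ≤ M)
    {c j : ℕ} (hB : (c + 1) * (M * P + M + 1) ≤ B)
    {xs : Fin j → V} {ys : Fin j → W} (hJ : Inv c 1 G G' xs ys) (x : V) :
    ∃ y, Atomic G G' (Fin.snoc xs x : Fin (j + 1) → V) (Fin.snoc ys y : Fin (j + 1) → W) := by
  classical
  have hA : Atomic G G' xs ys := fun i i' => hJ.atomic i i'
  have hat := fun i i' => (hJ.atomic i i').1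
  obtain ⟨ι, _, u, v, idx, h1, h2, h3, h4, h5, h6, h7, h8⟩ := hJ
  have hBe : (c + 1) * (M * P + M + 1) = c + M * (P * c) + M + M * c + M * P + 1 := by ring
  have hcu := card_rng u
  have hcv := card_rng v
  have hys : ∀ i, ys i ∈ rng v := fun i => mem_rng.2 ⟨_, (h3 i).symm⟩
  have key : ∃ y, ∀ i, (xs i = x ↔ ys i = y) ∧ (G.Adj x (xs i) ↔ G'.Adj y (ys i)) := by
    by_cases hxC : x ∈ rng u
    · obtain ⟨i, rfl⟩ := mem_rng.1 hxC
      refine ⟨v i, fun l => ⟨?_, ?_⟩⟩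
      · rw [h2, h3, u.injective.eq_iff, v.injective.eq_iff]
      · rw [h2, h3]; exact h4 _ _
    · have hbud : ∀ c' ≤ c, c' + M * (P * c') + M ≤ B := by
        intro c' hc'
        have := Nat.mul_le_mul_left M (Nat.mul_le_mul_left P hc')
        omega
      obtain ⟨y, hy, -, hI⟩ := resp hp g' hM (h := 1) le_rfl (by omega) hys hat h6
        (by rw [hcv]; exact hbud _ h1) h7 hxC (by
          intro S hS _ hSc
          have := Finset.card_pos.2 ⟨x, hS⟩
          omega)
      have hone : ∀ {U : Type} (K : SimpleGraph U) (p q : U), HW K 1 p q ↔ K.Adj p q := by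
        intro U K p q
        constructor
        · rintro ⟨w, hw⟩
          exact SimpleGraph.Walk.adj_of_length_eq_one hw
        · intro h
          exact ⟨SimpleGraph.Walk.cons h .nil, rfl⟩
      refine ⟨y, fun i => ⟨?_, ?_⟩⟩
      · constructor
        · intro h; exact absurd (mem_rng.2 ⟨_, (h2 i).symm.trans h⟩) hxC
        · intro h; exact absurd (h ▸ hys i) hy
      · rw [← hone, ← hone]; exact hI i
  obtain ⟨y, hy⟩ := key
  refine ⟨y, ?_⟩
  intro l l'
  induction l using Fin.lastCases with
  | last =>
    induction l' using Fin.lastCases with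
    | last => simp
    | cast i' =>
      simp only [Fin.snoc_last, Fin.snoc_castSucc]
      exact ⟨by rw [eq_comm, (hy i').1, eq_comm], (hy i').2⟩
  | cast i =>
    induction l' using Fin.lastCases with
    | last =>
      simp only [Fin.snoc_last, Fin.snoc_castSucc]
      exact ⟨(hy i).1, by rw [G.adj_comm, G'.adj_comm]; exact (hy i).2⟩
    | cast i' =>
      simp only [Fin.snoc_castSucc]
      exact hA i i'

lemma inv_eqv {M P Q a b B : ℕ} (hp : Par M P Q a b) (g : Good M P Q B G) (g' : Good M P Q B G') (hM : 4 ≤ M) :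
    ∀ (m c : ℕ), 2 * 2 ^ m ≤ M → (c + m * M + 1) * (M * P + M + 1) ≤ B →
    ∀ {j : ℕ} {xs : Fin j → V} {ys : Fin j → W}, Inv c (2 ^ m) G G' xs ys → Eqv G G' (m + 1) xs ys := by
  intro m
  induction m with
  | zero =>
    intro c hm hB j xs ys hJ
    have hB' : (c + 1) * (M * P + M + 1) ≤ B := by simpa using hB
    refine ⟨fun i i' => hJ.atomic i i', fun x => inv_last hp g' hM hB' hJ x, fun y => ?_⟩
    obtain ⟨x, hx⟩ := inv_last hp g hM hB' hJ.symm y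
    exact ⟨x, hx.symm⟩
  | succ m ih =>
    intro c hm hB j xs ys hJ
    have h2m : 1 ≤ 2 ^ m := Nat.one_le_two_pow
    rw [pow_succ, mul_comm (2 ^ m) 2] at hm hJ
    have hB1 : (c + 1) * (M * P + M + 1) ≤ B := le_trans (Nat.mul_le_mul_right _ (by
      have := Nat.zero_le ((m + 1) * M); omega)) hB
    have hB2 : (c + M + m * M + 1) * (M * P + M + 1) ≤ B := by
      refine le_trans (le_of_eq ?_) hB; ring
    refine ⟨fun i i' => hJ.atomic i i', fun x => ?_, fun y => ?_⟩
    · obtain ⟨y, hy⟩ := inv_step hp g g' hM h2m (by omega) hB1 hJ x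
      exact ⟨y, ih (c + M) (by omega) hB2 hy⟩
    · obtain ⟨x, hx⟩ := inv_step hp g' g hM h2m (by omega) hB1 hJ.symm y
      exact ⟨x, ih (c + M) (by omega) hB2 hx.symm⟩

lemma inv_first {M P Q a b B : ℕ} (hp : Par M P Q a b) (g : Good M P Q B G) (g' : Good M P Q B G')
    (hB : 1 + M * P + M ≤ B) {h : ℕ} (hM : 2 * h = M) (xs : Fin 0 → V) (ys : Fin 0 → W) (x : V) :
    ∃ y, Inv (1 + M * P) h G G' (Fin.snoc xs x : Fin (0 + 1) → V) (Fin.snoc ys y : Fin (0 + 1) → W) := by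
  classical
  obtain ⟨C, v, hxC, hCc, hcm, hcl, hcl'⟩ := first_copy hp g g' hB x
  have hr : rng (Function.Embedding.subtype (· ∈ C)) = C := by
    ext z; simp [rng]
  refine ⟨v ⟨x, hxC⟩, C, inferInstance, Function.Embedding.subtype (· ∈ C), v, fun _ => ⟨x, hxC⟩, ?_, ?_, ?_, ?_, ?_, ?_, ?_, ?_⟩
  · simpa using hCc
  · intro i
    rw [Subsingleton.elim (α := Fin 1) i (Fin.last 0)]
    rw [Fin.snoc_last]; rfl
  · intro i
    rw [Subsingleton.elim (α := Fin 1) i (Fin.last 0)]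
    rw [Fin.snoc_last]
  · intro i i'
    have : (G.comap (fun z : C => (z : V))).Adj i i' ↔ (G'.comap v).Adj i i' := by rw [hcm]
    exact this
  · rw [hr, hM]; exact hcl
  · rw [hM]; exact hcl'
  · rintro z - - ⟨i, i', hne, -⟩
    exact absurd (congrArg _ (Subsingleton.elim (α := Fin 1) i i')) hne
  · rintro z - - ⟨i, l, hne, -⟩
    exact absurd (congrArg _ (Subsingleton.elim (α := Fin 1) i l)) hne

/-- Duplicator wins between good graphs. -/
theorem good_eqv {M P Q a b B m : ℕ} (hp : Par M P Q a b) (hM : M = 2 ^ (m + 1)) (hm : 1 ≤ m)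
    (hB : (1 + M * P + m * M + 1) * (M * P + M + 1) ≤ B)
    (g : Good M P Q B G) (g' : Good M P Q B G') (xs : Fin 0 → V) (ys : Fin 0 → W) :
    Eqv G G' (m + 2) xs ys := by
  have hM4 : 4 ≤ M := by
    rw [hM]
    calc 4 = 2 ^ 2 := by norm_num
      _ ≤ 2 ^ (m + 1) := Nat.pow_le_pow_right (by norm_num) (by omega)
  have hM2 : 2 * 2 ^ m = M := by rw [hM]; ring
  have hB1 : 1 + M * P + M ≤ B := by
    refine le_trans ?_ (le_trans (Nat.le_mul_of_pos_left (M * P + M + 1) (n := 1 + M * P + m * M + 1) (by omega)) hB)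
    omega
  refine ⟨fun i => i.elim0, fun x => ?_, fun y => ?_⟩
  · obtain ⟨y, hy⟩ := inv_first hp g g' hB1 hM2 xs ys x
    exact ⟨y, inv_eqv hp g g' hM4 m _ hM2.le hB hy⟩
  · obtain ⟨x, hx⟩ := inv_first hp g' g hB1 hM2 ys xs y
    exact ⟨x, inv_eqv hp g g' hM4 m _ hM2.le hB hx.symm⟩

end Step

end ZOK

namespace ZOK
open RandomGraphSpectra FirstOrder.Language

section Logic
variable {V W : Type} [DecidableEq V] [DecidableEq W] {G : SimpleGraph V} {G' : SimpleGraph W}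

lemma Eqv.at {m j : ℕ} {xs : Fin j → V} {ys : Fin j → W} (h : Eqv G G' m xs ys) : Atomic G G' xs ys := by
  cases m with
  | zero => exact h
  | succ m => exact h.1

lemma term_var {j : ℕ} (t : Language.graph.Term (Empty ⊕ Fin j)) : ∃ i : Fin j, t = Term.var (Sum.inr i) := by
  cases t with
  | var v =>
    cases v with
    | inl e => exact e.elim
    | inr i => exact ⟨i, rfl⟩
  | func f _ => exact (IsEmpty.false f).elim

lemma realize_iff : ∀ {j : ℕ} (φ : Language.graph.BoundedFormula Empty j) (m : ℕ), qDepth φ ≤ m →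
    ∀ (xs : Fin j → V) (ys : Fin j → W), Eqv G G' m xs ys →
    (@BoundedFormula.Realize Language.graph V G.structure _ _ φ default xs ↔
      @BoundedFormula.Realize Language.graph W G'.structure _ _ φ default ys) := by
  intro j φ
  letI := G.structure
  letI := G'.structure
  induction φ with
  | falsum => intro m hm xs ys h; exact Iff.rfl
  | equal t₁ t₂ =>
    intro m hm xs ys h
    obtain ⟨i, rfl⟩ := term_var t₁
    obtain ⟨i', rfl⟩ := term_var t₂
    exact (h.at i i').1
  | rel R ts =>
    intro m hm xs ys h
    cases R with
    | adj =>
      obtain ⟨i, hi⟩ := term_var (ts 0)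
      obtain ⟨i', hi'⟩ := term_var (ts 1)
      have := (h.at i i').2
      simp only [BoundedFormula.Realize]
      change G.Adj ((ts 0).realize _) ((ts 1).realize _) ↔ G'.Adj ((ts 0).realize _) ((ts 1).realize _)
      rw [hi, hi']
      exact this
  | imp f g ihf ihg =>
    intro m hm xs ys h
    simp only [qDepth] at hm
    simp only [BoundedFormula.Realize]
    rw [ihf m (le_trans (le_max_left _ _) hm) xs ys h, ihg m (le_trans (le_max_right _ _) hm) xs ys h]
  | all f ih =>
    intro m hm xs ys h
    simp only [qDepth] at hm
    cases m with
    | zero => omega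
    | succ m =>
      simp only [BoundedFormula.Realize]
      constructor
      · intro hx y
        obtain ⟨x, hxy⟩ := h.2.2 y
        exact (ih m (by omega) _ _ hxy).1 (hx x)
      · intro hy x
        obtain ⟨y, hxy⟩ := h.2.1 x
        exact (ih m (by omega) _ _ hxy).2 (hy y)

lemma sat_iff (φ : Language.graph.Sentence) {m : ℕ} (hm : qDepth φ ≤ m)
    (h : ∀ (xs : Fin 0 → V) (ys : Fin 0 → W), Eqv G G' m xs ys) : GraphSat G φ ↔ GraphSat G' φ :=
  realize_iff φ m hm default default (h _ _)

end Logic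

end ZOK

namespace ZOK
open RandomGraphSpectra

section Prob
open Classical

/-- Edge set as a finset of unordered pairs. -/
noncomputable def eF {V : Type} [Fintype V] (G : SimpleGraph V) : Finset (Sym2 V) :=
  Finset.univ.filter (fun z => z ∈ G.edgeSet)

lemma mem_eF {V : Type} [Fintype V] (G : SimpleGraph V) (z : Sym2 V) : z ∈ eF G ↔ z ∈ G.edgeSet := by
  simp [eF]

lemma ed_univ {V : Type} [Fintype V] [DecidableEq V] (G : SimpleGraph V) : ed G Finset.univ = (eF G).card := by
  unfold ed eF
  congr 1

lemma edgeCount_eF {V : Type} [Fintype V] (G : SimpleGraph V) : edgeCount G = (eF G).card := by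
  unfold edgeCount
  rw [Nat.card_eq_fintype_card, Fintype.card_subtype]
  rfl

lemma top_card (n : ℕ) : (eF (⊤ : SimpleGraph (Fin n))).card = n.choose 2 := by
  have : eF (⊤ : SimpleGraph (Fin n)) = (⊤ : SimpleGraph (Fin n)).edgeFinset := by
    ext z; rw [mem_eF, SimpleGraph.mem_edgeFinset]
  rw [this, SimpleGraph.card_edgeFinset_top_eq_card_choose_two]
  simp

/-- Expectation in `G(n,p)`. -/
noncomputable def ex (n : ℕ) (p : ℝ) (f : SimpleGraph (Fin n) → ℝ) : ℝ :=
  ∑ G : SimpleGraph (Fin n), weight n p G * f G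

lemma probPred_eq (n : ℕ) (p : ℝ) (R : SimpleGraph (Fin n) → Prop) :
    probPred n p R = ex n p (fun G => if R G then 1 else 0) := by
  unfold probPred ex
  rw [finsum_eq_sum_of_fintype]
  apply Finset.sum_congr rfl
  intro G _
  by_cases h : R G <;> simp [h]

lemma ex_eF (n : ℕ) (p : ℝ) (g : Finset (Sym2 (Fin n)) → ℝ) :
    ex n p (fun G => g (eF G)) = ∑ A ∈ (eF (⊤ : SimpleGraph (Fin n))).powerset,
      p ^ A.card * (1 - p) ^ ((eF (⊤ : SimpleGraph (Fin n))) \ A).card * g A := by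
  unfold ex
  have hsub : ∀ G : SimpleGraph (Fin n), eF G ⊆ eF ⊤ := by
    intro G z hz
    rw [mem_eF] at *
    exact SimpleGraph.edgeSet_mono le_top hz
  refine Finset.sum_bij' (fun G _ => eF G) (fun A _ => SimpleGraph.fromEdgeSet (A : Set (Sym2 (Fin n)))) ?_ ?_ ?_ ?_ ?_
  · intro G _
    rw [Finset.mem_powerset]; exact hsub G
  · intro A _; exact Finset.mem_univ _
  · intro G _
    have : ((eF G : Finset _) : Set (Sym2 (Fin n))) = G.edgeSet := by
      ext z; simp [mem_eF]
    rw [this, SimpleGraph.fromEdgeSet_edgeSet]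
  · intro A hA
    rw [Finset.mem_powerset] at hA
    ext z
    rw [mem_eF, SimpleGraph.edgeSet_fromEdgeSet]
    constructor
    · intro h; exact h.1
    · intro h
      refine ⟨h, ?_⟩
      have := hA h
      rw [mem_eF] at this
      exact SimpleGraph.not_isDiag_of_mem_edgeSet _ this
  · intro G _
    unfold weight
    rw [edgeCount_eF, Finset.card_sdiff_of_subset (hsub G), top_card]

lemma ex_prod (n : ℕ) (p : ℝ) (F1 F0 : Finset (Sym2 (Fin n))) (h1 : F1 ⊆ eF ⊤) (h0 : F0 ⊆ eF ⊤)
    (hd : Disjoint F1 F0) :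
    ex n p (fun G => if F1 ⊆ eF G ∧ Disjoint F0 (eF G) then 1 else 0) = p ^ F1.card * (1 - p) ^ F0.card := by
  rw [ex_eF n p (fun A => if F1 ⊆ A ∧ Disjoint F0 A then 1 else 0)]
  set T := eF (⊤ : SimpleGraph (Fin n)) with hT
  have key := Finset.prod_add (fun i => if i ∈ F0 then (0:ℝ) else p) (fun i => if i ∈ F1 then (0:ℝ) else 1 - p) T
  have e1 : ∀ i ∈ T, ((if i ∈ F0 then (0:ℝ) else p) + (if i ∈ F1 then (0:ℝ) else 1 - p))
      = (if i ∈ F1 then p else 1) * (if i ∈ F0 then 1 - p else 1) := by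
    intro i _
    by_cases a : i ∈ F0 <;> by_cases b : i ∈ F1
    · exact absurd a (Finset.disjoint_left.mp hd b)
    all_goals simp [a, b]
  rw [Finset.prod_congr rfl e1, Finset.prod_mul_distrib, Finset.prod_ite_mem, Finset.prod_ite_mem,
    Finset.inter_eq_right.mpr h1, Finset.inter_eq_right.mpr h0, Finset.prod_const, Finset.prod_const] at key
  rw [key]
  apply Finset.sum_congr rfl
  intro A hA
  rw [Finset.mem_powerset] at hA
  by_cases c : F1 ⊆ A ∧ Disjoint F0 A
  · rw [if_pos c, mul_one]
    congr 1
    · rw [← Finset.prod_const]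
      apply Finset.prod_congr rfl
      intro i hi
      rw [if_neg (fun h => Finset.disjoint_left.mp c.2 h hi)]
    · rw [← Finset.prod_const]
      apply Finset.prod_congr rfl
      intro i hi
      rw [if_neg (fun h => (Finset.mem_sdiff.mp hi).2 (c.1 h))]
  · rw [if_neg c, mul_zero]
    symm
    rw [not_and_or] at c
    rcases c with c | c
    · obtain ⟨i, hi, hi'⟩ := Finset.not_subset.mp c
      apply mul_eq_zero_of_right
      exact Finset.prod_eq_zero (Finset.mem_sdiff.mpr ⟨h1 hi, hi'⟩) (if_pos hi)
    · obtain ⟨i, hi, hi'⟩ := Finset.not_disjoint_iff.mp c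
      apply mul_eq_zero_of_left
      exact Finset.prod_eq_zero hi' (if_pos hi)

lemma ex_sub (n : ℕ) (p : ℝ) (F1 : Finset (Sym2 (Fin n))) (h1 : F1 ⊆ eF ⊤) :
    ex n p (fun G => if F1 ⊆ eF G then 1 else 0) = p ^ F1.card := by
  have := ex_prod n p F1 ∅ h1 (by simp) (by simp)
  simpa using this

lemma ex_disj (n : ℕ) (p : ℝ) (F0 : Finset (Sym2 (Fin n))) (h1 : F0 ⊆ eF ⊤) :
    ex n p (fun G => if Disjoint F0 (eF G) then 1 else 0) = (1 - p) ^ F0.card := by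
  have := ex_prod n p ∅ F0 (by simp) h1 (by simp)
  simpa using this

lemma ex_one (n : ℕ) (p : ℝ) : ex n p (fun _ => 1) = 1 := by
  have := ex_prod n p ∅ ∅ (by simp) (by simp) (by simp)
  simpa using this

lemma weight_nonneg {n : ℕ} {p : ℝ} (h0 : 0 ≤ p) (h1 : p ≤ 1) (G : SimpleGraph (Fin n)) : 0 ≤ weight n p G :=
  mul_nonneg (pow_nonneg h0 _) (pow_nonneg (by linarith) _)

lemma ex_mono {n : ℕ} {p : ℝ} (h0 : 0 ≤ p) (h1 : p ≤ 1) {f g : SimpleGraph (Fin n) → ℝ} (h : ∀ G, f G ≤ g G) :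
    ex n p f ≤ ex n p g :=
  Finset.sum_le_sum (fun G _ => mul_le_mul_of_nonneg_left (h G) (weight_nonneg h0 h1 G))

lemma ex_nonneg {n : ℕ} {p : ℝ} (h0 : 0 ≤ p) (h1 : p ≤ 1) {f : SimpleGraph (Fin n) → ℝ} (h : ∀ G, 0 ≤ f G) :
    0 ≤ ex n p f :=
  Finset.sum_nonneg (fun G _ => mul_nonneg (weight_nonneg h0 h1 G) (h G))

lemma ex_add (n : ℕ) (p : ℝ) (f g : SimpleGraph (Fin n) → ℝ) :
    ex n p (fun G => f G + g G) = ex n p f + ex n p g := by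
  simp [ex, mul_add, Finset.sum_add_distrib]

lemma ex_mul (n : ℕ) (p c : ℝ) (f : SimpleGraph (Fin n) → ℝ) :
    ex n p (fun G => c * f G) = c * ex n p f := by
  simp only [ex, Finset.mul_sum]
  apply Finset.sum_congr rfl
  intro G _; ring

lemma ex_sum {ι : Type*} (n : ℕ) (p : ℝ) (s : Finset ι) (f : ι → SimpleGraph (Fin n) → ℝ) :
    ex n p (fun G => ∑ i ∈ s, f i G) = ∑ i ∈ s, ex n p (f i) := by
  simp only [ex, Finset.mul_sum]
  rw [Finset.sum_comm]

/-- image of the edges of `H` under an embedding. -/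
noncomputable def img {I : Type} [Fintype I] {n : ℕ} (H : SimpleGraph I) (φ : I ↪ Fin n) : Finset (Sym2 (Fin n)) :=
  (eF H).image (Sym2.map φ)

lemma img_card {I : Type} [Fintype I] {n : ℕ} (H : SimpleGraph I) (φ : I ↪ Fin n) :
    (img H φ).card = (eF H).card :=
  Finset.card_image_of_injective _ (Sym2.map.injective φ.injective)

lemma img_sub {I : Type} [Fintype I] {n : ℕ} (H : SimpleGraph I) (φ : I ↪ Fin n) (G : SimpleGraph (Fin n)) :
    img H φ ⊆ eF G ↔ H ≤ G.comap φ := by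
  constructor
  · intro h i j hij
    have : Sym2.map φ s(i, j) ∈ img H φ := Finset.mem_image_of_mem _ (by rw [mem_eF]; exact hij)
    have := h this
    rw [mem_eF] at this
    simpa using this
  · intro h z hz
    obtain ⟨y, hy, rfl⟩ := Finset.mem_image.mp hz
    rw [mem_eF] at *
    induction y using Sym2.ind with
    | _ i j =>
      have := h (show H.Adj i j from hy)
      simpa using this

lemma img_top {I : Type} [Fintype I] {n : ℕ} (H : SimpleGraph I) (φ : I ↪ Fin n) : img H φ ⊆ eF ⊤ := by
  rw [img_sub]
  intro i j hij
  have := hij.ne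
  simpa using this

lemma ex_copy {I : Type} [Fintype I] (n : ℕ) (p : ℝ) (H : SimpleGraph I) (φ : I ↪ Fin n) :
    ex n p (fun G => if H ≤ G.comap φ then 1 else 0) = p ^ (eF H).card := by
  rw [← img_card H φ, ← ex_sub n p _ (img_top H φ)]
  congr 1
  ext G
  simp only [img_sub]

/-- Number of copies. -/
noncomputable def cnt {I : Type} [Fintype I] {n : ℕ} (H : SimpleGraph I) (G : SimpleGraph (Fin n)) : ℝ :=
  ∑ φ : I ↪ Fin n, if H ≤ G.comap φ then 1 else 0

lemma ex_cnt {I : Type} [Fintype I] (n : ℕ) (p : ℝ) (H : SimpleGraph I) :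
    ex n p (cnt H) = (n.descFactorial (Fintype.card I) : ℝ) * p ^ (eF H).card := by
  unfold cnt
  rw [ex_sum]
  simp only [ex_copy]
  rw [Finset.sum_const, Finset.card_univ, Fintype.card_embedding_eq, Fintype.card_fin, nsmul_eq_mul]

/-- number of dense placements. -/
noncomputable def dcnt (I : Type) [Fintype I] {n : ℕ} (m : ℕ) (G : SimpleGraph (Fin n)) : ℝ :=
  ∑ χ : I ↪ Fin n, if m ≤ (eF (G.comap χ)).card then 1 else 0

lemma ex_dcnt (I : Type) [Fintype I] (n : ℕ) {p : ℝ} (h0 : 0 ≤ p) (h1 : p ≤ 1) (m : ℕ) :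
    ex n p (dcnt I m) ≤ (Nat.card (SimpleGraph I) : ℝ) * ((n : ℝ) ^ (Fintype.card I) * p ^ m) := by
  have hle : ∀ G : SimpleGraph (Fin n), dcnt I m G ≤
      ∑ H ∈ (Finset.univ : Finset (SimpleGraph I)).filter (fun H => m ≤ (eF H).card), cnt H G := by
    intro G
    unfold dcnt cnt
    rw [Finset.sum_comm]
    apply Finset.sum_le_sum
    intro χ _
    have hnn : ∀ H ∈ (Finset.univ : Finset (SimpleGraph I)).filter (fun H => m ≤ (eF H).card),
        (0:ℝ) ≤ if H ≤ G.comap χ then 1 else 0 := by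
      intro H _; split_ifs <;> norm_num
    split_ifs with hc
    · have := Finset.single_le_sum hnn (a := G.comap χ) (by simpa using hc)
      simpa using this
    · exact Finset.sum_nonneg hnn
  refine (ex_mono h0 h1 hle).trans ?_
  rw [ex_sum]
  have : ∀ H ∈ (Finset.univ : Finset (SimpleGraph I)).filter (fun H => m ≤ (eF H).card),
      ex n p (cnt H) ≤ (n : ℝ) ^ (Fintype.card I) * p ^ m := by
    intro H hH
    rw [ex_cnt]
    have hm : m ≤ (eF H).card := by simpa using hH
    have : (n.descFactorial (Fintype.card I) : ℝ) ≤ (n : ℝ) ^ (Fintype.card I) := by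
      exact_mod_cast Nat.descFactorial_le_pow _ _
    exact mul_le_mul this (pow_le_pow_of_le_one h0 h1 hm) (by positivity) (by positivity)
  refine (Finset.sum_le_card_nsmul _ _ _ this).trans ?_
  rw [nsmul_eq_mul]
  apply mul_le_mul_of_nonneg_right _ (by positivity)
  rw [Nat.card_eq_fintype_card]
  exact_mod_cast Finset.card_le_univ _

end Prob
end ZOK

namespace ZOK
open RandomGraphSpectra

section Prob2
open Classical

/-- overlap set -/
noncomputable def ovl {s n : ℕ} (φ ψ : Fin s ↪ Fin n) : Finset (Fin s) :=
  Finset.univ.filter (fun j => ∃ i, φ i = ψ j)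

lemma inter_card {s n : ℕ} (H : SimpleGraph (Fin s)) (φ ψ : Fin s ↪ Fin n) :
    (img H φ ∩ img H ψ).card ≤ ed H (ovl φ ψ) := by
  have : img H φ ∩ img H ψ ⊆ (((ovl φ ψ).sym2).filter (fun z => z ∈ H.edgeSet)).image (Sym2.map ψ) := by
    intro z hz
    obtain ⟨h1, h2⟩ := Finset.mem_inter.mp hz
    obtain ⟨y, hy, rfl⟩ := Finset.mem_image.mp h2
    obtain ⟨x, hx, hxy⟩ := Finset.mem_image.mp h1
    refine Finset.mem_image_of_mem _ ?_
    rw [Finset.mem_filter]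
    refine ⟨?_, (mem_eF _ _).mp hy⟩
    rw [Finset.mem_sym2_iff]
    intro j hj
    have : ψ j ∈ Sym2.map φ x := by
      rw [hxy]; exact Sym2.mem_map.mpr ⟨j, hj, rfl⟩
    obtain ⟨i, _, hi⟩ := Sym2.mem_map.mp this
    simp only [ovl, Finset.mem_filter, Finset.mem_univ, true_and]
    exact ⟨i, hi⟩
  refine (Finset.card_le_card this).trans (Finset.card_image_le.trans (le_of_eq ?_))
  unfold ed
  congr 1

lemma ovl_count {s n : ℕ} (φ : Fin s ↪ Fin n) (T : Finset (Fin s)) :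
    ((Finset.univ.filter (fun ψ : Fin s ↪ Fin n => ovl φ ψ = T)).card : ℝ) ≤ (s : ℝ) ^ T.card * (n : ℝ) ^ (s - T.card) := by
  have h1 : (Finset.image (fun (ψ : Fin s ↪ Fin n) => (ψ : Fin s → Fin n))
      (Finset.univ.filter (fun ψ : Fin s ↪ Fin n => ovl φ ψ = T)))
      ⊆ Fintype.piFinset (fun j => if j ∈ T then Finset.univ.image φ else Finset.univ) := by
    intro f hf
    obtain ⟨ψ, hψ, rfl⟩ := Finset.mem_image.mp hf
    rw [Finset.mem_filter] at hψ
    rw [Fintype.mem_piFinset]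
    intro j
    split_ifs with hj
    · rw [← hψ.2] at hj
      simp only [ovl, Finset.mem_filter, Finset.mem_univ, true_and] at hj
      obtain ⟨i, hi⟩ := hj
      exact Finset.mem_image.mpr ⟨i, Finset.mem_univ _, hi⟩
    · exact Finset.mem_univ _
  have h2 := Finset.card_le_card h1
  rw [Finset.card_image_of_injective _ (fun x y h => DFunLike.coe_injective h), Fintype.card_piFinset] at h2
  have h3 : (∏ j : Fin s, (if j ∈ T then Finset.univ.image φ else Finset.univ).card) = s ^ T.card * n ^ (s - T.card) := by
    have : ∀ j : Fin s, (if j ∈ T then Finset.univ.image φ else Finset.univ).card = if j ∈ T then s else n := by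
      intro j
      split_ifs
      · rw [Finset.card_image_of_injective _ φ.injective]; simp
      · simp
    simp only [this]
    rw [Finset.prod_ite, Finset.prod_const, Finset.prod_const]
    congr 2
    · congr 1; ext; simp
    · have : (Finset.univ.filter (fun j => j ∉ T)) = Tᶜ := by ext; simp
      rw [this, Finset.card_compl]; simp
  rw [h3] at h2
  exact_mod_cast h2

lemma ex_sq {s : ℕ} (n : ℕ) {p : ℝ} (h0 : 0 ≤ p) (h1 : p ≤ 1) (H : SimpleGraph (Fin s)) :
    ex n p (fun G => cnt H G ^ 2) ≤ ((n.descFactorial s : ℝ) * p ^ (eF H).card) ^ 2 +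
      ∑ T ∈ (Finset.univ : Finset (Finset (Fin s))).filter (fun T => T.Nonempty),
        (n : ℝ) ^ s * ((s : ℝ) ^ T.card * (n : ℝ) ^ (s - T.card) * p ^ (2 * (eF H).card - ed H T)) := by
  set e := (eF H).card with he
  have c1 : ∀ G : SimpleGraph (Fin n), cnt H G ^ 2 = ∑ φ : Fin s ↪ Fin n, ∑ ψ : Fin s ↪ Fin n,
      if img H φ ∪ img H ψ ⊆ eF G then (1:ℝ) else 0 := by
    intro G
    unfold cnt
    rw [sq, Finset.sum_mul_sum]
    refine Finset.sum_congr rfl (fun φ _ => Finset.sum_congr rfl (fun ψ _ => ?_))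
    rw [← img_sub, ← img_sub]
    simp only [Finset.union_subset_iff]
    by_cases a : img H φ ⊆ eF G <;> by_cases b : img H ψ ⊆ eF G <;> simp [a, b]
  simp only [c1]
  rw [ex_sum]
  have c2 : ∀ φ : Fin s ↪ Fin n, ex n p (fun G => ∑ ψ : Fin s ↪ Fin n,
      if img H φ ∪ img H ψ ⊆ eF G then (1:ℝ) else 0) ≤ (n.descFactorial s : ℝ) * (p ^ e * p ^ e) +
      ∑ T ∈ (Finset.univ : Finset (Finset (Fin s))).filter (fun T => T.Nonempty),
        ((s : ℝ) ^ T.card * (n : ℝ) ^ (s - T.card) * p ^ (2 * e - ed H T)) := by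
    intro φ
    rw [ex_sum]
    have c3 : ∀ ψ : Fin s ↪ Fin n, ex n p (fun G => if img H φ ∪ img H ψ ⊆ eF G then (1:ℝ) else 0) ≤
        p ^ e * p ^ e + ∑ T ∈ (Finset.univ : Finset (Finset (Fin s))).filter (fun T => T.Nonempty),
          (if ovl φ ψ = T then (1:ℝ) else 0) * p ^ (2 * e - ed H T) := by
      intro ψ
      rw [ex_sub _ _ _ (Finset.union_subset (img_top _ _) (img_top _ _))]
      have hnn : ∀ T ∈ (Finset.univ : Finset (Finset (Fin s))).filter (fun T => T.Nonempty),
          0 ≤ (if ovl φ ψ = T then (1:ℝ) else 0) * p ^ (2 * e - ed H T) := by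
        intro T _
        apply mul_nonneg _ (by positivity)
        split_ifs <;> norm_num
      have hc := Finset.card_union_add_card_inter (img H φ) (img H ψ)
      rw [img_card, img_card] at hc
      have hi := inter_card H φ ψ
      have hle : p ^ (img H φ ∪ img H ψ).card ≤ p ^ (2 * e - ed H (ovl φ ψ)) :=
        pow_le_pow_of_le_one h0 h1 (by omega)
      by_cases hT : (ovl φ ψ).Nonempty
      · have := Finset.single_le_sum hnn (a := ovl φ ψ) (by simpa using hT)
        rw [if_pos rfl, one_mul] at this
        have h4 : 0 ≤ p ^ e * p ^ e := by positivity
        linarith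
      · rw [Finset.not_nonempty_iff_eq_empty] at hT
        rw [hT, ed_empty] at hle
        have h4 : p ^ (2 * e - 0) = p ^ e * p ^ e := by rw [← pow_add]; congr 1; omega
        have := Finset.sum_nonneg hnn
        linarith
    refine (Finset.sum_le_sum (fun ψ _ => c3 ψ)).trans ?_
    rw [Finset.sum_add_distrib, Finset.sum_const, Finset.card_univ, Fintype.card_embedding_eq, Fintype.card_fin,
      Fintype.card_fin, nsmul_eq_mul]
    gcongr
    rw [Finset.sum_comm]
    apply Finset.sum_le_sum
    intro T _
    rw [← Finset.sum_mul]
    gcongr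
    have := ovl_count φ T
    rw [Finset.sum_boole]
    exact this
  refine (Finset.sum_le_sum (fun φ _ => c2 φ)).trans ?_
  rw [Finset.sum_const, Finset.card_univ, Fintype.card_embedding_eq, Fintype.card_fin,
      Fintype.card_fin, nsmul_eq_mul, mul_add, ← Finset.mul_sum]
  have hd : (n.descFactorial s : ℝ) ≤ (n : ℝ) ^ s := by
    exact_mod_cast Nat.descFactorial_le_pow _ _
  have hnn : 0 ≤ ∑ T ∈ (Finset.univ : Finset (Finset (Fin s))).filter (fun T => T.Nonempty),
        ((s : ℝ) ^ T.card * (n : ℝ) ^ (s - T.card) * p ^ (2 * e - ed H T)) :=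
    Finset.sum_nonneg (fun T _ => by positivity)
  have := mul_le_mul_of_nonneg_right hd hnn
  have e2 : (n.descFactorial s : ℝ) * ((n.descFactorial s : ℝ) * (p ^ e * p ^ e)) = ((n.descFactorial s : ℝ) * p ^ e) ^ 2 := by ring
  linarith

/-- failure of the embedding property for `H`. -/
def Fail (M : ℕ) {s n : ℕ} (H : SimpleGraph (Fin s)) (G : SimpleGraph (Fin n)) : Prop :=
  ¬ ∃ φ : Fin s ↪ Fin n, H ≤ G.comap φ ∧ ∀ U : Finset (Fin n), Disjoint U (Finset.univ.map φ) →
      U.card + 1 ≤ M → ed G (Finset.univ.map φ ∪ U) ≤ ed H Finset.univ + U.card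

lemma fail_le {M s n : ℕ} {H : SimpleGraph (Fin s)} {G : SimpleGraph (Fin n)} (hF : Fail M H G) :
    cnt H G ≤ ∑ t ∈ Finset.range M, dcnt (Fin s ⊕ Fin t) ((eF H).card + t + 1) G := by
  unfold Fail at hF
  push Not at hF
  have key : ∀ φ : Fin s ↪ Fin n, H ≤ G.comap φ → ∃ t : Fin M, ∃ χ : (Fin s ⊕ Fin t) ↪ Fin n,
      (∀ i, χ (Sum.inl i) = φ i) ∧ (eF H).card + t + 1 ≤ (eF (G.comap χ)).card := by
    intro φ hφ
    obtain ⟨U, hd, hU, hed⟩ := hF φ hφ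
    have hinj : Function.Injective (Sum.elim φ (U.equivFin.symm · |>.1) : Fin s ⊕ Fin U.card → Fin n) := by
      refine Function.Injective.sumElim φ.injective ?_ ?_
      · intro x y hxy
        exact U.equivFin.symm.injective (Subtype.ext hxy)
      · intro x y hxy
        refine Finset.disjoint_left.mp hd (U.equivFin.symm y).2 ?_
        simp only [Finset.mem_map, Finset.mem_univ, true_and]
        exact ⟨x, hxy⟩
    refine ⟨⟨U.card, by omega⟩, ⟨_, hinj⟩, fun i => rfl, ?_⟩
    set χ : (Fin s ⊕ Fin U.card) ↪ Fin n := ⟨_, hinj⟩ with hχ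
    have hm : Finset.univ.map χ = Finset.univ.map φ ∪ U := by
      ext z
      simp only [Finset.mem_map, Finset.mem_univ, true_and, Finset.mem_union]
      constructor
      · rintro ⟨x | x, rfl⟩
        · left; exact ⟨x, rfl⟩
        · right; exact (U.equivFin.symm x).2
      · rintro (⟨x, rfl⟩ | hz)
        · exact ⟨Sum.inl x, rfl⟩
        · refine ⟨Sum.inr (U.equivFin ⟨z, hz⟩), ?_⟩
          simp [hχ]
    have h5 := ed_map (G := G) χ Finset.univ
    rw [hm, ed_univ] at h5
    rw [ed_univ] at hed
    rw [h5] at hed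
    change (eF H).card + U.card + 1 ≤ (eF (G.comap χ)).card
    omega
  have e1 : cnt H G = ((Finset.univ.filter (fun φ : Fin s ↪ Fin n => H ≤ G.comap φ)).card : ℝ) := by
    unfold cnt; rw [Finset.sum_boole]
  have e2 : ∑ t ∈ Finset.range M, dcnt (Fin s ⊕ Fin t) ((eF H).card + t + 1) G =
      (((Finset.univ : Finset (Fin M)).sigma (fun t => Finset.univ.filter (fun χ : (Fin s ⊕ Fin t) ↪ Fin n =>
        (eF H).card + t + 1 ≤ (eF (G.comap χ)).card))).card : ℝ) := by
    rw [Finset.card_sigma, Finset.sum_range]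
    push_cast
    refine Finset.sum_congr rfl (fun t _ => ?_)
    unfold dcnt; rw [Finset.sum_boole]
  rw [e1, e2]
  norm_cast
  apply Finset.card_le_card_of_surjOn (fun x => Function.Embedding.inl.trans x.2)
  intro φ hφ
  have hφ' : H ≤ G.comap φ := by simpa using hφ
  obtain ⟨t, χ, h1, h2⟩ := key φ hφ'
  refine ⟨⟨t, χ⟩, ?_, ?_⟩
  · simpa using h2
  · ext i
    simp [h1 i]

lemma fail_prob {M s : ℕ} (n : ℕ) {p : ℝ} (h0 : 0 ≤ p) (h1 : p ≤ 1) (H : SimpleGraph (Fin s)) {L : ℝ}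
    (hL : L = (n.descFactorial s : ℝ) * p ^ (eF H).card) (hpos : 0 < L) :
    ex n p (fun G => if Fail M H G then 1 else 0) ≤
      4 / L ^ 2 * (∑ T ∈ (Finset.univ : Finset (Finset (Fin s))).filter (fun T => T.Nonempty),
        (n : ℝ) ^ s * ((s : ℝ) ^ T.card * (n : ℝ) ^ (s - T.card) * p ^ (2 * (eF H).card - ed H T))) +
      2 / L * ∑ t ∈ Finset.range M, (Nat.card (SimpleGraph (Fin s ⊕ Fin t)) : ℝ) *
        ((n : ℝ) ^ (s + t) * p ^ ((eF H).card + t + 1)) := by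
  have hpt : ∀ G : SimpleGraph (Fin n), (if Fail M H G then (1:ℝ) else 0) ≤
      4 / L ^ 2 * (cnt H G ^ 2 + ((-2 * L) * cnt H G + L ^ 2 * 1)) +
      2 / L * ∑ t ∈ Finset.range M, dcnt (Fin s ⊕ Fin t) ((eF H).card + t + 1) G := by
    intro G
    have hX : cnt H G ^ 2 + ((-2 * L) * cnt H G + L ^ 2 * 1) = (L - cnt H G) ^ 2 := by ring
    rw [hX]
    set X := cnt H G
    have hYn : 0 ≤ ∑ t ∈ Finset.range M, dcnt (Fin s ⊕ Fin t) ((eF H).card + t + 1) G := by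
      refine Finset.sum_nonneg (fun t _ => Finset.sum_nonneg (fun χ _ => ?_))
      split_ifs <;> norm_num
    have hXY : Fail M H G → X ≤ _ := fun h => fail_le h
    set Y := ∑ t ∈ Finset.range M, dcnt (Fin s ⊕ Fin t) ((eF H).card + t + 1) G
    have hA : 0 ≤ 4 / L ^ 2 * (L - X) ^ 2 := by positivity
    have hB : 0 ≤ 2 / L * Y := by positivity
    split_ifs with hf
    · have := hXY hf
      by_cases hY : L / 2 ≤ Y
      · have : 1 ≤ 2 / L * Y := by
          rw [div_mul_eq_mul_div, le_div_iff₀ hpos]; linarith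
        linarith
      · have : 1 ≤ 4 / L ^ 2 * (L - X) ^ 2 := by
          rw [div_mul_eq_mul_div, le_div_iff₀ (by positivity)]
          nlinarith
        linarith
    · linarith
  refine (ex_mono h0 h1 hpt).trans ?_
  rw [ex_add, ex_mul, ex_mul, ex_add, ex_add, ex_mul, ex_mul, ex_sum, ex_one]
  have hc := ex_cnt n p H
  rw [Fintype.card_fin, ← hL] at hc
  rw [hc]
  have hs := ex_sq n h0 h1 H
  rw [← hL] at hs
  apply add_le_add
  · apply mul_le_mul_of_nonneg_left _ (by positivity)
    linarith
  · apply mul_le_mul_of_nonneg_left _ (by positivity)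
    refine Finset.sum_le_sum (fun t _ => ?_)
    have := ex_dcnt (Fin s ⊕ Fin t) n h0 h1 ((eF H).card + t + 1)
    rw [Fintype.card_sum, Fintype.card_fin, Fintype.card_fin] at this
    exact this

end Prob2
end ZOK

namespace ZOK
open RandomGraphSpectra

section Lim
open Classical

lemma p_nonneg (α : ℝ) (n : ℕ) : 0 ≤ (n : ℝ) ^ (-α) := Real.rpow_nonneg (Nat.cast_nonneg n) _

lemma p_le_one {α : ℝ} (hα : 0 ≤ α) {n : ℕ} (hn : 1 ≤ n) : (n : ℝ) ^ (-α) ≤ 1 :=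
  Real.rpow_le_one_of_one_le_of_nonpos (by exact_mod_cast hn) (by linarith)

lemma pow_form (α : ℝ) (x y : ℕ) {n : ℕ} (hn : 1 ≤ n) :
    (n : ℝ) ^ x * ((n : ℝ) ^ (-α)) ^ y = (n : ℝ) ^ ((x : ℝ) - α * y) := by
  have h : (0:ℝ) < n := by exact_mod_cast hn
  rw [← Real.rpow_natCast (n : ℝ) x, ← Real.rpow_natCast _ y, ← Real.rpow_mul h.le, ← Real.rpow_add h]
  congr 1; ring

lemma lim_zero {α : ℝ} {x y : ℕ} (h : (x : ℝ) < α * y) :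
    Tendsto (fun n : ℕ => (n : ℝ) ^ x * ((n : ℝ) ^ (-α)) ^ y) atTop (nhds 0) := by
  have h1 : Tendsto (fun n : ℕ => (n : ℝ) ^ (-(α * y - x))) atTop (nhds 0) :=
    (tendsto_rpow_neg_atTop (by linarith)).comp tendsto_natCast_atTop_atTop
  refine h1.congr' ?_
  filter_upwards [eventually_ge_atTop 1] with n hn
  rw [pow_form α x y hn]; congr 1; ring

lemma lim_inv {α : ℝ} {x y : ℕ} (h : α * y < x) :
    Tendsto (fun n : ℕ => ((n : ℝ) ^ x * ((n : ℝ) ^ (-α)) ^ y)⁻¹) atTop (nhds 0) := by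
  have h1 : Tendsto (fun n : ℕ => (n : ℝ) ^ (-((x:ℝ) - α * y))) atTop (nhds 0) :=
    (tendsto_rpow_neg_atTop (by linarith)).comp tendsto_natCast_atTop_atTop
  refine h1.congr' ?_
  filter_upwards [eventually_ge_atTop 1] with n hn
  rw [pow_form α x y hn, Real.rpow_neg (Nat.cast_nonneg n)]

/-- An event whose probability tends to zero. -/
def Null (α : ℝ) (R : ∀ n : ℕ, SimpleGraph (Fin n) → Prop) : Prop :=
  Tendsto (fun n : ℕ => ex n ((n : ℝ) ^ (-α)) (fun G => if R n G then 1 else 0)) atTop (nhds 0)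

lemma null_of_le {α : ℝ} (hα : 0 ≤ α) {R : ∀ n : ℕ, SimpleGraph (Fin n) → Prop} {f : ℕ → ℝ}
    (hf : Tendsto f atTop (nhds 0))
    (h : ∀ᶠ n : ℕ in atTop, ex n ((n : ℝ) ^ (-α)) (fun G => if R n G then 1 else 0) ≤ f n) : Null α R := by
  refine squeeze_zero' ?_ h hf
  filter_upwards [eventually_ge_atTop 1] with n hn
  refine ex_nonneg (p_nonneg α n) (p_le_one hα hn) (fun G => ?_)
  split_ifs <;> norm_num

lemma Null.mono {α : ℝ} (hα : 0 ≤ α) {R R' : ∀ n : ℕ, SimpleGraph (Fin n) → Prop} (h : Null α R)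
    (hR : ∀ n G, R' n G → R n G) : Null α R' := by
  refine null_of_le hα h ?_
  filter_upwards [eventually_ge_atTop 1] with n hn
  refine ex_mono (p_nonneg α n) (p_le_one hα hn) (fun G => ?_)
  by_cases h1 : R' n G
  · simp [h1, hR n G h1]
  · rw [if_neg h1]; split_ifs <;> norm_num

lemma null_union {α : ℝ} (hα : 0 ≤ α) {ι : Type*} [Fintype ι] {R : ι → ∀ n : ℕ, SimpleGraph (Fin n) → Prop}
    (h : ∀ i, Null α (R i)) : Null α (fun n G => ∃ i, R i n G) := by
  have h1 := tendsto_finsetSum (Finset.univ : Finset ι) (fun i _ => h i)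
  rw [Finset.sum_const_zero] at h1
  refine null_of_le hα h1 ?_
  filter_upwards [eventually_ge_atTop 1] with n hn
  rw [← ex_sum]
  refine ex_mono (p_nonneg α n) (p_le_one hα hn) (fun G => ?_)
  have hnn : ∀ i ∈ (Finset.univ : Finset ι), (0:ℝ) ≤ if R i n G then 1 else 0 := by
    intro i _; split_ifs <;> norm_num
  split_ifs with hc
  · obtain ⟨i, hi⟩ := hc
    have := Finset.single_le_sum hnn (Finset.mem_univ i)
    simpa [hi] using this
  · exact Finset.sum_nonneg hnn

lemma null_or {α : ℝ} (hα : 0 ≤ α) {R R' : ∀ n : ℕ, SimpleGraph (Fin n) → Prop} (h : Null α R) (h' : Null α R') :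
    Null α (fun n G => R n G ∨ R' n G) := by
  have h1 : Null α (fun n G => ∃ i : Bool, (if i then R else R') n G) := by
    apply null_union hα
    intro i; cases i
    · simpa using h'
    · simpa using h
  refine h1.mono hα (fun n G hh => ?_)
  rcases hh with hh | hh
  · exact ⟨true, by simpa using hh⟩
  · exact ⟨false, by simpa using hh⟩

/-- Dense subgraphs. -/
lemma null_dense {α : ℝ} (hα : 0 ≤ α) {P Q : ℕ} (hQ : 0 < Q) (hP : 0 < P) (hPQ : α = (Q : ℝ) / P) (s : ℕ) :
    Null α (fun n G => ∃ S : Finset (Fin n), S.card = s ∧ P * s < Q * ed G S) := by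
  set m := P * s / Q + 1 with hm
  have hm1 : P * s < Q * m := Nat.lt_mul_div_succ _ hQ
  have hlt : (s : ℝ) < α * m := by
    rw [hPQ, div_mul_eq_mul_div, lt_div_iff₀ (by exact_mod_cast hP)]
    have : ((P * s : ℕ) : ℝ) < ((Q * m : ℕ) : ℝ) := by exact_mod_cast hm1
    push_cast at this
    push_cast
    linarith
  have hl := (lim_zero hlt).const_mul (Nat.card (SimpleGraph (Fin s)) : ℝ)
  rw [mul_zero] at hl
  refine null_of_le hα hl ?_
  filter_upwards [eventually_ge_atTop 1] with n hn
  have h2 := ex_dcnt (Fin s) n (p_nonneg α n) (p_le_one hα hn) m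
  rw [Fintype.card_fin] at h2
  refine le_trans (ex_mono (p_nonneg α n) (p_le_one hα hn) (fun G => ?_)) h2
  have hnn : ∀ χ ∈ (Finset.univ : Finset (Fin s ↪ Fin n)), (0:ℝ) ≤ if m ≤ (eF (G.comap χ)).card then 1 else 0 := by
    intro i _; split_ifs <;> norm_num
  split_ifs with hc
  · obtain ⟨S, hS, hd⟩ := hc
    subst hS
    let χ : Fin S.card ↪ Fin n := S.equivFin.symm.toEmbedding.trans (Function.Embedding.subtype _)
    have hmap : Finset.univ.map χ = S := by
      ext z
      simp only [Finset.mem_map, Finset.mem_univ, true_and]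
      constructor
      · rintro ⟨x, rfl⟩; exact (S.equivFin.symm x).2
      · intro hz; exact ⟨S.equivFin ⟨z, hz⟩, by simp [χ]⟩
    have h5 := ed_map (G := G) χ Finset.univ
    rw [hmap, ed_univ] at h5
    have h6 : m ≤ (eF (G.comap χ)).card := by
      rw [← h5, hm]
      have := (Nat.div_lt_iff_lt_mul hQ).mpr (by rw [mul_comm (ed G S)]; exact hd)
      omega
    have := Finset.single_le_sum hnn (Finset.mem_univ χ)
    rw [if_pos h6] at this
    exact this
  · exact Finset.sum_nonneg hnn

lemma null_embed {α : ℝ} (hα : 0 ≤ α) {M s : ℕ} (H : SimpleGraph (Fin s))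
    (hH : ∀ S : Finset (Fin s), S.Nonempty → α * (ed H S : ℝ) < S.card)
    (hM : ∀ t < M, (t : ℝ) < α * (t + 1)) :
    Null α (fun n G => Fail M H G) := by
  set e := (eF H).card with he
  have l1 : Tendsto (fun n : ℕ => ∑ T ∈ (Finset.univ : Finset (Finset (Fin s))).filter (fun T => T.Nonempty),
      (4 * 4 ^ s * (s : ℝ) ^ T.card) * ((n : ℝ) ^ T.card * ((n : ℝ) ^ (-α)) ^ (ed H T))⁻¹) atTop (nhds 0) := by
    have := tendsto_finsetSum ((Finset.univ : Finset (Finset (Fin s))).filter (fun T => T.Nonempty))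
      (fun T hT => (lim_inv (hH T (by simpa using hT))).const_mul (4 * 4 ^ s * (s : ℝ) ^ T.card))
    simpa using this
  have l2 : Tendsto (fun n : ℕ => ∑ t ∈ Finset.range M, (2 * 2 ^ s * (Nat.card (SimpleGraph (Fin s ⊕ Fin t)) : ℝ)) *
      ((n : ℝ) ^ t * ((n : ℝ) ^ (-α)) ^ (t + 1))) atTop (nhds 0) := by
    have := tendsto_finsetSum (Finset.range M)
      (fun t ht => (lim_zero (α := α) (x := t) (y := t + 1)
        (by have := hM t (by simpa using ht); push_cast; exact this)).const_mul
          (2 * 2 ^ s * (Nat.card (SimpleGraph (Fin s ⊕ Fin t)) : ℝ)))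
    simpa using this
  have l3 := l1.add l2
  rw [add_zero] at l3
  refine null_of_le hα l3 ?_
  filter_upwards [eventually_ge_atTop 1, eventually_ge_atTop (2 * s)] with n hn hn2
  have hnpos : (0:ℝ) < n := by exact_mod_cast hn
  have hp0 : 0 < (n : ℝ) ^ (-α) := Real.rpow_pos_of_pos hnpos _
  have hp1 := p_le_one hα hn
  set p := (n : ℝ) ^ (-α) with hp
  have hd : ((n : ℝ) / 2) ^ s ≤ (n.descFactorial s : ℝ) := by
    have h1 : ((n + 1 - s : ℕ) : ℝ) ^ s ≤ (n.descFactorial s : ℝ) := by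
      exact_mod_cast Nat.pow_sub_le_descFactorial n s
    refine le_trans (pow_le_pow_left₀ (by positivity) ?_ s) h1
    have : ((n + 1 - s : ℕ) : ℝ) = n + 1 - s := by
      rw [Nat.cast_sub (by omega)]; push_cast; ring
    rw [this]
    have : (2 * s : ℝ) ≤ n := by exact_mod_cast hn2
    linarith
  have hL0 : 0 < ((n : ℝ) / 2) ^ s * p ^ e := by positivity
  have hLL : ((n : ℝ) / 2) ^ s * p ^ e ≤ (n.descFactorial s : ℝ) * p ^ e := by gcongr
  refine (fail_prob (M := M) n hp0.le hp1 H rfl (lt_of_lt_of_le hL0 hLL)).trans ?_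
  rw [Finset.mul_sum, Finset.mul_sum]
  apply add_le_add
  · apply Finset.sum_le_sum
    intro T _
    have hTs : T.card ≤ s := by simpa using Finset.card_le_univ T
    have hTe : ed H T ≤ e := by rw [he, ← ed_univ]; exact ed_mono (Finset.subset_univ _)
    refine le_trans (mul_le_mul_of_nonneg_right (div_le_div_of_nonneg_left (by norm_num) (pow_pos hL0 2)
      (pow_le_pow_left₀ hL0.le hLL 2)) (by positivity)) (le_of_eq ?_)
    have e1 : p ^ (2 * e) = p ^ (2 * e - ed H T) * p ^ (ed H T) := by rw [← pow_add]; congr 1; omega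
    have e2 : (n : ℝ) ^ s = (n : ℝ) ^ (s - T.card) * (n : ℝ) ^ T.card := by rw [← pow_add]; congr 1; omega
    have e3 : (((n : ℝ) / 2) ^ s * p ^ e) ^ 2 = (n : ℝ) ^ s * ((n : ℝ) ^ (s - T.card) * (n : ℝ) ^ T.card) *
        (p ^ (2 * e - ed H T) * p ^ (ed H T)) / 4 ^ s := by
      rw [← e1, ← e2, div_pow, show (4:ℝ) = 2 * 2 by norm_num, mul_pow (2:ℝ) 2 s, two_mul, pow_add]
      field_simp
    rw [e3]
    change _ * ((n : ℝ) ^ s * ((s : ℝ) ^ T.card * (n : ℝ) ^ (s - T.card) * p ^ (2 * e - ed H T))) = _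
    have q1 : p ^ (2 * e - ed H T) ≠ 0 := by positivity
    have q2 : p ^ (ed H T) ≠ 0 := by positivity
    have q3 : (n : ℝ) ^ s ≠ 0 := by positivity
    have q4 : (n : ℝ) ^ (s - T.card) ≠ 0 := by positivity
    have q5 : (n : ℝ) ^ T.card ≠ 0 := by positivity
    generalize p ^ (2 * e - ed H T) = z1 at *
    generalize p ^ (ed H T) = z2 at *
    generalize (n : ℝ) ^ s = z3 at *
    generalize (n : ℝ) ^ (s - T.card) = z4 at *
    generalize (n : ℝ) ^ T.card = z5 at *
    field_simp
  · apply Finset.sum_le_sum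
    intro t _
    refine le_trans (mul_le_mul_of_nonneg_right (div_le_div_of_nonneg_left (by norm_num) hL0 hLL)
      (by positivity)) (le_of_eq ?_)
    change _ * (_ * ((n : ℝ) ^ (s + t) * p ^ (e + t + 1))) = _
    rw [add_assoc e t 1, pow_add, pow_add p e (t + 1), div_pow]
    have q1 : p ^ e ≠ 0 := by positivity
    have q3 : (n : ℝ) ^ s ≠ 0 := by positivity
    generalize p ^ e = z1 at *
    generalize (n : ℝ) ^ s = z3 at *
    field_simp

/-- Some vertex has at most `B` neighbours. -/
def LowDeg (B : ℕ) {n : ℕ} (G : SimpleGraph (Fin n)) : Prop :=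
  ∃ v : Fin n, ∃ S : Finset (Fin n), S.card ≤ B ∧ ∀ w, w ∉ S → ¬ G.Adj v w

lemma null_deg {α : ℝ} (hα : 0 ≤ α) (hα1 : α < 1) (B : ℕ) :
    Null α (fun _ G => LowDeg B G) := by
  have hc : 0 < 1 - α := by linarith
  have l0 : Tendsto (fun n : ℕ => (n : ℝ) ^ (1 - α)) atTop atTop :=
    (tendsto_rpow_atTop hc).comp tendsto_natCast_atTop_atTop
  have l1 := (tendsto_rpow_mul_exp_neg_mul_atTop_nhds_zero (((B + 1 : ℕ) : ℝ) / (1 - α)) (1/2) (by norm_num)).comp l0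
  refine null_of_le hα l1 ?_
  filter_upwards [eventually_ge_atTop 1, eventually_ge_atTop (2 * (B + 1))] with n hn hn2
  have hnpos : (0:ℝ) < n := by exact_mod_cast hn
  have hp0 : 0 < (n : ℝ) ^ (-α) := Real.rpow_pos_of_pos hnpos _
  have hp1 := p_le_one hα hn
  have hnp : (n : ℝ) ^ (1 - α) = n * (n : ℝ) ^ (-α) := by
    rw [sub_eq_add_neg, Real.rpow_add hnpos, Real.rpow_one]
  simp only [Function.comp]
  rw [← Real.rpow_mul hnpos.le, mul_div_cancel₀ _ hc.ne', Real.rpow_natCast, hnp]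
  set p := (n : ℝ) ^ (-α) with hp
  let F : Fin n × (Fin B → Fin n) → Finset (Sym2 (Fin n)) := fun x =>
    ((insert x.1 (Finset.univ.image x.2))ᶜ).image (fun w => s(x.1, w))
  have hFtop : ∀ x, F x ⊆ eF ⊤ := by
    intro x z hz
    obtain ⟨w, hw, rfl⟩ := Finset.mem_image.mp hz
    rw [Finset.mem_compl, Finset.mem_insert, not_or] at hw
    rw [mem_eF, SimpleGraph.mem_edgeSet, SimpleGraph.top_adj]
    exact fun h => hw.1 h.symm
  have hFcard : ∀ x, n - (B + 1) ≤ (F x).card := by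
    intro x
    have : (F x).card = ((insert x.1 (Finset.univ.image x.2))ᶜ).card := by
      apply Finset.card_image_of_injective
      intro w w' h
      exact Sym2.congr_right.mp h
    rw [this, Finset.card_compl, Fintype.card_fin]
    have h1 := Finset.card_insert_le x.1 (Finset.univ.image x.2)
    have h2 : (Finset.univ.image x.2).card ≤ B := by
      simpa using Finset.card_image_le (s := Finset.univ) (f := x.2)
    omega
  have hpt : ∀ G : SimpleGraph (Fin n),
      (if LowDeg B G then (1:ℝ) else 0) ≤
      ∑ x : Fin n × (Fin B → Fin n), if Disjoint (F x) (eF G) then (1:ℝ) else 0 := by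
    intro G
    have hnn : ∀ x ∈ (Finset.univ : Finset (Fin n × (Fin B → Fin n))), (0:ℝ) ≤ if Disjoint (F x) (eF G) then 1 else 0 := by
      intro i _; split_ifs <;> norm_num
    split_ifs with hb
    · obtain ⟨v, S, hS, hw⟩ := hb
      let f : Fin B → Fin n := fun i => if h : i.1 < S.card then (S.equivFin.symm ⟨i.1, h⟩).1 else v
      have hSf : ∀ w, w ∈ S → w ∈ Finset.univ.image f := by
        intro w hw
        refine Finset.mem_image.mpr ⟨⟨(S.equivFin ⟨w, hw⟩).1, lt_of_lt_of_le (S.equivFin ⟨w, hw⟩).2 hS⟩, Finset.mem_univ _, ?_⟩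
        simp [f]
      have hd : Disjoint (F (v, f)) (eF G) := by
        rw [Finset.disjoint_left]
        intro z hz hz'
        obtain ⟨w, hw', rfl⟩ := Finset.mem_image.mp hz
        rw [Finset.mem_compl, Finset.mem_insert, not_or] at hw'
        rw [mem_eF, SimpleGraph.mem_edgeSet] at hz'
        exact hw w (fun h => hw'.2 (hSf w h)) hz'
      have := Finset.single_le_sum hnn (Finset.mem_univ (v, f))
      rw [if_pos hd] at this
      exact this
    · exact Finset.sum_nonneg hnn
  refine (ex_mono hp0.le hp1 hpt).trans ?_
  rw [ex_sum]
  have hterm : ∀ x ∈ (Finset.univ : Finset (Fin n × (Fin B → Fin n))),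
      ex n p (fun G => if Disjoint (F x) (eF G) then (1:ℝ) else 0) ≤ Real.exp (-(1/2) * (n * p)) := by
    intro x _
    rw [ex_disj n p _ (hFtop x)]
    have h1 : (1 - p) ^ (F x).card ≤ Real.exp (-p) ^ (F x).card :=
      pow_le_pow_left₀ (by linarith) (Real.one_sub_le_exp_neg p) _
    refine h1.trans ?_
    rw [← Real.exp_nat_mul, Real.exp_le_exp]
    have h2 : (n : ℝ) / 2 ≤ ((F x).card : ℝ) := by
      have := hFcard x
      have h3 : n ≤ 2 * (F x).card := by omega
      have h4 : (n : ℝ) ≤ 2 * (F x).card := by exact_mod_cast h3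
      linarith
    nlinarith
  refine (Finset.sum_le_card_nsmul _ _ _ hterm).trans (le_of_eq ?_)
  rw [nsmul_eq_mul]
  congr 1
  simp [pow_succ, mul_comm]

lemma good_null {M P Q a b : ℕ} (hp : Par M P Q a b) {α : ℝ} (hPQ : α = (Q : ℝ) / P) (B : ℕ) :
    Null α (fun n G => ¬ Good M P Q B G) := by
  have hP := hp.hP
  have hQ := hp.hQ
  have ha := hp.ha
  have hb := hp.hb
  have hM := hp.hM
  have hMb : 2 * b ≤ M * b := Nat.mul_le_mul_right _ hM
  have hQ0 : 0 < Q := by omega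
  have hP0 : 0 < P := by omega
  have hPr : (0:ℝ) < P := by exact_mod_cast hP0
  have hα : 0 ≤ α := by rw [hPQ]; positivity
  have hα1 : α < 1 := by
    rw [hPQ, div_lt_one hPr]; exact_mod_cast (by omega : Q < P)
  have n1 : Null α (fun n G => ∃ s : Fin (B + 1), ∃ S : Finset (Fin n), S.card = (s : ℕ) ∧ P * (s : ℕ) < Q * ed G S) :=
    null_union hα (fun s => null_dense hα hQ0 hP0 hPQ s)
  have n2 := null_deg hα hα1 B
  have n3 : Null α (fun n G => ∃ x : (Σ s : Fin (B + 1), SimpleGraph (Fin s)),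
      (∀ S : Finset (Fin x.1), S.Nonempty → Q * ed x.2 S < P * S.card) ∧ Fail M x.2 G) := by
    apply null_union hα
    intro x
    by_cases hx : ∀ S : Finset (Fin x.1), S.Nonempty → Q * ed x.2 S < P * S.card
    · refine (null_embed (M := M) hα x.2 ?_ ?_).mono hα (fun n G h => h.2)
      · intro S hS
        rw [hPQ, div_mul_eq_mul_div, div_lt_iff₀ hPr]
        have := hx S hS
        rw [mul_comm P] at this
        exact_mod_cast this
      · intro t ht
        rw [hPQ, div_mul_eq_mul_div, lt_div_iff₀ hPr]
        have h1 : (t + 1) * b ≤ M * b := Nat.mul_le_mul_right _ ht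
        have h2 : t * P < Q * (t + 1) := by
          rw [← hQ] at hP ⊢
          nlinarith
        exact_mod_cast h2
    · refine null_of_le hα (tendsto_const_nhds (x := (0:ℝ))) (Eventually.of_forall (fun n => ?_))
      simp [hx, ex]
  refine (null_or hα n1 (null_or hα n2 n3)).mono hα ?_
  intro n G hG
  by_contra hcon
  push Not at hcon
  obtain ⟨c1, c2, c3⟩ := hcon
  unfold LowDeg at c2
  push Not at c2
  apply hG
  refine ⟨?_, ?_, ?_⟩
  · intro S hS
    have := c1 ⟨S.card, by omega⟩ S rfl
    exact this
  · intro v S hS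
    exact c2 v S hS
  · intro s hs H hH
    have := c3 ⟨⟨s, by omega⟩, H⟩ hH
    unfold Fail at this
    push Not at this
    simpa using this

end Lim
end ZOK

namespace ZOK
open RandomGraphSpectra

section Final
open Classical

lemma final_law {M P Q a b m B : ℕ} (hp : Par M P Q a b) (hM : M = 2 ^ (m + 1)) (hm : 1 ≤ m)
    (hB : (1 + M * P + m * M + 1) * (M * P + M + 1) ≤ B) {α : ℝ} (hα : 0 ≤ α) (hPQ : α = (Q : ℝ) / P) :
    ZeroOneKLaw (m + 2) (fun n : ℕ => (n : ℝ) ^ (-α)) := by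
  intro φ hφ
  have hN := good_null hp hPQ B
  by_cases hex : ∃ n : ℕ, ∃ G : SimpleGraph (Fin n), Good M P Q B G ∧ GraphSat G φ
  · right
    obtain ⟨n0, G0, hG0, hs0⟩ := hex
    have h1 : Null α (fun n G => ¬ GraphSat G φ) := by
      refine hN.mono hα (fun n G h hg => h ?_)
      exact (sat_iff φ hφ (fun xs ys => good_eqv hp hM hm hB hG0 hg xs ys)).mp hs0
    have h2 := (tendsto_const_nhds (x := (1:ℝ))).sub h1
    rw [sub_zero] at h2
    refine h2.congr (fun n => ?_)
    unfold probSat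
    rw [probPred_eq, sub_eq_iff_eq_add, ← ex_add]
    conv_lhs => rw [← ex_one n ((n : ℝ) ^ (-α))]
    congr 1
    ext G
    by_cases h : GraphSat G φ <;> simp [h]
  · left
    have h1 : Null α (fun n G => GraphSat G φ) := by
      refine hN.mono hα (fun n G h hg => hex ⟨n, G, hg, h⟩)
    refine h1.congr (fun n => ?_)
    unfold probSat
    rw [probPred_eq]

end Final
end ZOK

namespace RandomGraphSpectra

/-- Zero-one `k`-law for `α = 1 - 1/(2^{k-1} + a/b)` with `a/b` an irreducible positive
fraction, `max{1, 2^{k-1} - b} ≤ a ≤ 2^{k-1}`. -/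
theorem zero_one_k_law_rational_exponent (k a b : ℕ) (hk : 3 < k) (hb : 1 ≤ b) (ha : 1 ≤ a)
    (hirr : Nat.Coprime a b) (hν : max 1 (2 ^ (k - 1) - b) ≤ a) (ha2 : a ≤ 2 ^ (k - 1))
    (α : ℝ) (hα : α = 1 - 1 / ((2 : ℝ) ^ (k - 1) + (a : ℝ) / (b : ℝ))) :
    ZeroOneKLaw k (fun n : ℕ => (n : ℝ) ^ (-α)) := by
  obtain ⟨m, rfl⟩ : ∃ m, k = m + 2 := ⟨k - 2, by omega⟩
  have hk1 : m + 2 - 1 = m + 1 := by omega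
  rw [hk1] at hν ha2 hα
  have hM2 : 2 ≤ 2 ^ (m + 1) := by
    rw [pow_succ]; have := Nat.one_le_two_pow (n := m); omega
  set M := 2 ^ (m + 1) with hM
  have hbM : b ≤ M * b := Nat.le_mul_of_pos_left _ (by omega)
  have hp : ZOK.Par M (M * b + a) (M * b + a - b) a b := by
    refine ⟨hM2, rfl, by omega, ha, hb, ?_, ?_⟩
    · have := le_trans (le_max_right _ _) hν
      omega
    · have : Nat.Coprime (a + M * b) b := by simpa using hirr
      rwa [add_comm] at this
  have hb0 : (0:ℝ) < b := by exact_mod_cast hb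
  have ha0 : (0:ℝ) < a := by exact_mod_cast ha
  have hMr : ((M : ℕ) : ℝ) = (2:ℝ) ^ (m + 1) := by rw [hM]; push_cast; rfl
  have hM0 : (0:ℝ) < M := by rw [hMr]; positivity
  have hPQ : α = ((M * b + a - b : ℕ) : ℝ) / ((M * b + a : ℕ) : ℝ) := by
    rw [hα, Nat.cast_sub (by omega), ← hMr]
    push_cast
    field_simp
  have hα0 : 0 ≤ α := by rw [hPQ]; positivity
  exact ZOK.final_law hp hM (by omega) le_rfl hα0 hPQ

end RandomGraphSpectra
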